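/- arXiv:1909.05562 — 9 statements merged into one kernel-verified Lean document; each statement's English description precedes it below -/
import Mathlib

section
/- Let n ≥ 1, let k ∈ ℤⁿ with k ≠ 0, let c ∈ ℝ and δ > 0. Then the Lebesgue measure of the set {ω ∈ (0,2π)ⁿ : |⟨k,ω⟩ + c| < δ} is at most 2n(2π)^{n-1} δ / |k|. -/
open MeasureTheory

/-- The set of reals on which a non-constant affine function is smaller than `δ` in absolute
value is an interval of length `2 * δ / |a|`. -/
theorem volume_abs_mul_add_lt_le {a : ℝ} (ha : a ≠ 0) (b δ : ℝ) :
    volume {x : ℝ | |a * x + b| < δ} ≤ ENNReal.ofReal (2 * (δ / |a|)) := by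
  have hsub : {x : ℝ | |a * x + b| < δ} ⊆ Metric.ball (-b / a) (δ / |a|) := by
    intro x hx
    rw [Metric.mem_ball, Real.dist_eq, lt_div_iff₀ (abs_pos.mpr ha), ← abs_mul]
    have h : (x - -b / a) * a = a * x + b := by field_simp; ring
    rwa [h]
  exact (measure_mono hsub).trans_eq (Real.volume_ball _ _)

/-- The part of the open cube `(0, L)ᵐ⁺¹` where an affine form is smaller than `δ` in absolute
value, estimated by slicing along a coordinate with nonzero coefficient. -/
theorem volume_cube_inter_abs_affine_lt_le {m : ℕ} {L : ℝ} (hL : 0 ≤ L) (a : Fin (m + 1) → ℝ)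
    (j : Fin (m + 1)) (ha : a j ≠ 0) (c δ : ℝ) :
    volume {ω : Fin (m + 1) → ℝ |
        (∀ i, ω i ∈ Set.Ioo 0 L) ∧ |(∑ i, a i * ω i) + c| < δ}
      ≤ ENNReal.ofReal (L ^ m * (2 * (δ / |a j|))) := by
  set Q : Set (Fin m → ℝ) := Set.univ.pi fun _ => Set.Ioo 0 L
  have hQ : MeasurableSet Q := MeasurableSet.univ_pi fun _ => measurableSet_Ioo
  have hQvol : volume Q = ENNReal.ofReal (L ^ m) := by
    simp [Q, volume_pi_pi, ENNReal.ofReal_pow hL]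
  set f : ℝ × (Fin m → ℝ) → ℝ := fun p =>
    |a j * p.1 + ((∑ i, a (j.succAbove i) * p.2 i) + c)|
  have hf : Continuous f := by fun_prop
  set T : Set (ℝ × (Fin m → ℝ)) := {p | p.2 ∈ Q ∧ f p < δ}
  have hT : MeasurableSet T :=
    (measurable_snd hQ).inter (measurableSet_lt hf.measurable measurable_const)
  have hmp := volume_preserving_piFinSuccAbove (fun _ : Fin (m + 1) => ℝ) j
  have hsub : {ω : Fin (m + 1) → ℝ |
      (∀ i, ω i ∈ Set.Ioo 0 L) ∧ |(∑ i, a i * ω i) + c| < δ} ⊆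
      MeasurableEquiv.piFinSuccAbove (fun _ => ℝ) j ⁻¹' T := by
    rintro ω ⟨hω, h⟩
    refine ⟨fun i _ => hω _, ?_⟩
    rw [Fin.sum_univ_succAbove _ j, add_assoc] at h
    exact h
  calc _ ≤ volume T := (measure_mono hsub).trans_eq (hmp.measure_preimage hT.nullMeasurableSet)
    _ = ∫⁻ y, volume ((fun x => (x, y)) ⁻¹' T) := Measure.prod_apply_symm hT
    _ ≤ ∫⁻ y, Q.indicator (fun _ => ENNReal.ofReal (2 * (δ / |a j|))) y := by
        refine lintegral_mono fun y => ?_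
        by_cases hy : y ∈ Q
        · rw [Set.indicator_of_mem hy]
          refine le_trans (measure_mono fun x hx => ?_)
            (volume_abs_mul_add_lt_le ha ((∑ i, a (j.succAbove i) * y i) + c) δ)
          exact hx.2
        · have : (fun x : ℝ => (x, y)) ⁻¹' T = ∅ :=
            Set.eq_empty_of_forall_notMem fun x hx => hy hx.1
          simp [this]
    _ = ENNReal.ofReal (L ^ m * (2 * (δ / |a j|))) := by
        rw [lintegral_indicator_const hQ, hQvol, mul_comm, ENNReal.ofReal_mul (pow_nonneg hL m)]

/-- Let n ≥ 1, k ∈ ℤⁿ with k ≠ 0, c ∈ ℝ and δ > 0. Then the Lebesgue measure of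
{ω ∈ (0,2π)ⁿ : |⟨k,ω⟩ + c| < δ} is at most 2n(2π)^{n-1} δ / |k|. -/
theorem stmt1 (n : ℕ) (hn : 1 ≤ n) (k : Fin n → ℤ) (hk : k ≠ 0) (c δ : ℝ) (hδ : 0 < δ) :
    volume {ω : Fin n → ℝ |
        (∀ i, ω i ∈ Set.Ioo 0 (2 * Real.pi)) ∧ |(∑ i, (k i : ℝ) * ω i) + c| < δ}
      ≤ ENNReal.ofReal
          (2 * n * (2 * Real.pi) ^ (n - 1) * δ / ((∑ i, |k i| : ℤ) : ℝ)) := by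
  obtain ⟨m, rfl⟩ : ∃ m, n = m + 1 := ⟨n - 1, by omega⟩
  obtain ⟨j, hj⟩ := Finite.exists_max fun i => |k i|
  obtain ⟨i₀, hi₀⟩ := Function.ne_iff.mp hk
  have hkj : 0 < |k j| := (abs_pos.mpr hi₀).trans_le (hj i₀)
  have hsum : 0 < ∑ i, |k i| :=
    hkj.trans_le (Finset.single_le_sum (fun i _ => abs_nonneg (k i)) (Finset.mem_univ j))
  have hle : ∑ i, |k i| ≤ ((m + 1 : ℕ) : ℤ) * |k j| := by
    simpa using Finset.sum_le_card_nsmul Finset.univ (fun i => |k i|) _ fun i _ => hj i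
  have hkj' : (0 : ℝ) < |(k j : ℝ)| := by exact_mod_cast hkj
  have hsum' : (0 : ℝ) < ((∑ i, |k i| : ℤ) : ℝ) := by exact_mod_cast hsum
  have hle' : ((∑ i, |k i| : ℤ) : ℝ) ≤ ((m + 1 : ℕ) : ℝ) * |(k j : ℝ)| := by exact_mod_cast hle
  refine (volume_cube_inter_abs_affine_lt_le Real.two_pi_pos.le (fun i => (k i : ℝ)) j
    (abs_pos.mp hkj') c δ).trans (ENNReal.ofReal_le_ofReal ?_)
  rw [Nat.add_sub_cancel]
  calc (2 * Real.pi) ^ m * (2 * (δ / |(k j : ℝ)|))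
      = 2 * (2 * Real.pi) ^ m * δ * (1 / |(k j : ℝ)|) := by ring
    _ ≤ 2 * (2 * Real.pi) ^ m * δ * (((m + 1 : ℕ) : ℝ) / ((∑ i, |k i| : ℤ) : ℝ)) := by
        refine mul_le_mul_of_nonneg_left ?_ (by positivity)
        rwa [div_le_div_iff₀ hkj' hsum', one_mul]
    _ = _ := by ring
end

section
/- Let n ≥ 1, let τ be a real number with 0 < τ ≤ n − 3/4, let γ > 0, let m ≥ 1 be an integer, let ω ∈ ℝⁿ and v = (v₁,…,v_d) ∈ ℝ^d. Assume: (i) for every k ∈ ℤⁿ with 0 < |k| ≤ 2m and all i, j ∈ {1,…,d}, |⟨k,ω⟩ − v_i + v_j| ≥ γ/(1 + |k|^τ); and (ii) for every k ∈ ℤⁿ with 0 < |k| ≤ 2m, all i, j, i', j' ∈ {1,…,d} and all sign choices ε₁,ε₂,ε₃,ε₄ ∈ {−1,+1}, |⟨k,ω⟩ + ε₁v_i + ε₂v_j + ε₃v_{i'} + ε₄v_{j'}| ≥ γ/(1 + |k|^τ). Define D_k(ω) = min_{1≤i,j≤d} |⟨k,ω⟩ − v_i + v_j|. Then ∑_{k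 ∈ ℤⁿ, 0 < |k| ≤ m} D_k(ω)^{−2} ≤ 2^{2n+3} m^{2τ} / γ². -/
/-- If the function `D` is bounded below by `δ`, and any two of its values at points of
`s` that are distinct and not related by the map `σ` differ by at least `δ`, then the inverse
squares of its values sum to at most `4 / δ ^ 2`. -/
lemma sum_inv_sq_le_of_separated {ι : Type*} [DecidableEq ι] (s : Finset ι) (σ : ι → ι)
    (D : ι → ℝ) {δ : ℝ} (hδ : 0 < δ) (hD : ∀ k ∈ s, δ ≤ D k)
    (hsep : ∀ k ∈ s, ∀ l ∈ s, l ≠ k → l ≠ σ k → δ ≤ |D k - D l|) :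
    ∑ k ∈ s, (D k ^ 2)⁻¹ ≤ 4 / δ ^ 2 := by
  set N : ι → ℕ := fun k => ⌊D k / δ⌋₊ with hN
  have hN1 : ∀ k ∈ s, 1 ≤ N k := fun k hk => by
    rw [hN, Nat.one_le_floor_iff, one_le_div hδ]
    exact hD k hk
  have hfloor : ∀ k ∈ s, (N k : ℝ) * δ ≤ D k ∧ D k < (N k + 1) * δ := fun k hk => by
    have h0 : 0 ≤ D k / δ := div_nonneg (hδ.le.trans (hD k hk)) hδ.le
    exact ⟨(le_div_iff₀ hδ).1 (Nat.floor_le h0), (div_lt_iff₀ hδ).1 (Nat.lt_floor_add_one _)⟩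
  have hcard : ∀ b ∈ s.image N, (s.filter fun a => N a = b).card ≤ 2 := by
    intro b hb
    obtain ⟨k, hk, rfl⟩ := Finset.mem_image.1 hb
    refine (Finset.card_le_card (t := {k, σ k}) fun l hl => ?_).trans Finset.card_le_two
    obtain ⟨hl, hlk⟩ := Finset.mem_filter.1 hl
    by_contra hne
    simp only [Finset.mem_insert, Finset.mem_singleton, not_or] at hne
    have h := hsep k hk l hl hne.1 hne.2
    have hk' := hfloor k hk
    have hl' := hfloor l hl
    rw [hlk] at hl'
    have : |D k - D l| < δ := abs_lt.2 ⟨by linarith, by linarith⟩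
    linarith
  have himage : ∑ b ∈ s.image N, ((b : ℝ) ^ 2)⁻¹ ≤ 2 := by
    have hsub : s.image N ⊆ Finset.Ioo 0 ((s.image N).sup id + 1) := fun b hb => by
      have hle : b ≤ (s.image N).sup id := Finset.le_sup (f := id) hb
      obtain ⟨k, hk, rfl⟩ := Finset.mem_image.1 hb
      have := hN1 k hk
      exact Finset.mem_Ioo.2 ⟨by omega, by omega⟩
    refine (Finset.sum_le_sum_of_subset_of_nonneg hsub fun _ _ _ => by positivity).trans ?_
    simpa using sum_Ioo_inv_sq_le (α := ℝ) 0 ((s.image N).sup id + 1)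
  calc ∑ k ∈ s, (D k ^ 2)⁻¹ ≤ ∑ k ∈ s, (δ ^ 2)⁻¹ * ((N k : ℝ) ^ 2)⁻¹ := by
        refine Finset.sum_le_sum fun k hk => ?_
        have hpos : (0 : ℝ) < N k := by exact_mod_cast hN1 k hk
        rw [← mul_inv, ← mul_pow, mul_comm]
        gcongr
        exact (hfloor k hk).1
    _ = (δ ^ 2)⁻¹ * ∑ b ∈ s.image N,
          (s.filter fun a => N a = b).card • ((b : ℝ) ^ 2)⁻¹ := by
        rw [← Finset.mul_sum, Finset.sum_comp (fun b : ℕ => ((b : ℝ) ^ 2)⁻¹) N]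
    _ ≤ (δ ^ 2)⁻¹ * (2 * ∑ b ∈ s.image N, ((b : ℝ) ^ 2)⁻¹) := by
        gcongr
        rw [Finset.mul_sum]
        refine Finset.sum_le_sum fun b hb => ?_
        rw [nsmul_eq_mul]
        gcongr
        exact_mod_cast hcard b hb
    _ ≤ (δ ^ 2)⁻¹ * (2 * 2) := by gcongr
    _ = 4 / δ ^ 2 := by ring

lemma sum_abs_pos_of_ne_zero {n : ℕ} {k : Fin n → ℤ} (hk : k ≠ 0) : 0 < ∑ l, |k l| := by
  obtain ⟨i, hi⟩ := Function.ne_iff.1 hk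
  exact Finset.sum_pos' (fun _ _ => abs_nonneg _) ⟨i, Finset.mem_univ _, abs_pos.2 hi⟩

lemma four_div_sq_le {n : ℕ} {τ γ x : ℝ} (hτ0 : 0 ≤ τ) (hτ : τ ≤ (n : ℝ) - 3 / 4)
    (hx : 1 ≤ x) :
    4 / (γ / (1 + (2 * x) ^ τ)) ^ 2 ≤ 2 ^ (2 * n + 3) * x ^ (2 * τ) / γ ^ 2 := by
  have hx0 : 0 ≤ x := zero_le_one.trans hx
  have h1 : 1 ≤ (2 * x) ^ τ := Real.one_le_rpow (by linarith) hτ0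
  have h2 : (2 : ℝ) ^ (2 * τ) * 16 ≤ 2 ^ (2 * n + 3) := by
    have h16 : (16 : ℝ) = 2 ^ (4 : ℝ) := by norm_num
    rw [h16, ← Real.rpow_add two_pos, ← Real.rpow_natCast]
    refine Real.rpow_le_rpow_of_exponent_le one_le_two ?_
    push_cast
    linarith
  have h3 : ((2 * x) ^ τ) ^ 2 = (2 : ℝ) ^ (2 * τ) * x ^ (2 * τ) := by
    rw [← Real.mul_rpow two_pos.le hx0, ← Real.rpow_mul_natCast (by positivity)]
    push_cast
    rw [mul_comm τ]
  have h4 : 4 * (1 + (2 * x) ^ τ) ^ 2 ≤ 2 ^ (2 * n + 3) * x ^ (2 * τ) :=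
    calc 4 * (1 + (2 * x) ^ τ) ^ 2 ≤ 4 * ((2 * x) ^ τ + (2 * x) ^ τ) ^ 2 := by gcongr
      _ = (2 : ℝ) ^ (2 * τ) * 16 * x ^ (2 * τ) := by linear_combination 16 * h3
      _ ≤ _ := by gcongr
  rw [div_pow, div_div_eq_mul_div]
  gcongr


/-- Under Diophantine-type lower bounds on |⟨k,ω⟩ − v_i + v_j| and on second order
combinations, the sum of D_k(ω)⁻² over 0 < |k| ≤ m is at most 2^{2n+3} m^{2τ}/γ². -/
theorem stmt3 (n d : ℕ) (hn : 1 ≤ n) (hd : 1 ≤ d) (τ γ : ℝ)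
    (hτ0 : 0 < τ) (hτ : τ ≤ (n : ℝ) - 3 / 4) (hγ : 0 < γ)
    (m : ℕ) (hm : 1 ≤ m) (ω : Fin n → ℝ) (v : Fin d → ℝ)
    (h1 : ∀ k : Fin n → ℤ, 0 < ∑ l, |k l| → ∑ l, |k l| ≤ 2 * (m : ℤ) →
      ∀ i j : Fin d,
        γ / (1 + (((∑ l, |k l| : ℤ) : ℝ)) ^ τ) ≤
          |(∑ l, (k l : ℝ) * ω l) - v i + v j|)
    (h2 : ∀ k : Fin n → ℤ, 0 < ∑ l, |k l| → ∑ l, |k l| ≤ 2 * (m : ℤ) →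
      ∀ i j i' j' : Fin d, ∀ e₁ e₂ e₃ e₄ : ℝ,
        (e₁ = 1 ∨ e₁ = -1) → (e₂ = 1 ∨ e₂ = -1) → (e₃ = 1 ∨ e₃ = -1) →
        (e₄ = 1 ∨ e₄ = -1) →
        γ / (1 + (((∑ l, |k l| : ℤ) : ℝ)) ^ τ) ≤
          |(∑ l, (k l : ℝ) * ω l) + e₁ * v i + e₂ * v j + e₃ * v i' + e₄ * v j'|) :
    ∑ k ∈ (Finset.Icc (fun _ => -(m : ℤ)) fun _ => (m : ℤ)).filter
        (fun k : Fin n → ℤ => 0 < ∑ l, |k l| ∧ ∑ l, |k l| ≤ (m : ℤ)),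
      ((⨅ i : Fin d, ⨅ j : Fin d, |(∑ l, (k l : ℝ) * ω l) - v i + v j|) ^ 2)⁻¹ ≤
      2 ^ (2 * n + 3) * (m : ℝ) ^ (2 * τ) / γ ^ 2 := by
  have : Nonempty (Fin d) := ⟨⟨0, hd⟩⟩
  have hattained : ∀ k : Fin n → ℤ, ∃ i j : Fin d,
      (⨅ i : Fin d, ⨅ j : Fin d, |(∑ l, (k l : ℝ) * ω l) - v i + v j|) =
        |(∑ l, (k l : ℝ) * ω l) - v i + v j| := fun k => by
    obtain ⟨i, hi⟩ := exists_eq_ciInf_of_finite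
      (f := fun i : Fin d => ⨅ j : Fin d, |(∑ l, (k l : ℝ) * ω l) - v i + v j|)
    obtain ⟨j, hj⟩ := exists_eq_ciInf_of_finite
      (f := fun j : Fin d => |(∑ l, (k l : ℝ) * ω l) - v i + v j|)
    exact ⟨i, j, hi.symm.trans hj.symm⟩
  have hδ : 0 < γ / (1 + (2 * (m : ℝ)) ^ τ) := by positivity
  have hmono : ∀ a : ℤ, 0 < a → a ≤ 2 * (m : ℤ) →
      γ / (1 + (2 * (m : ℝ)) ^ τ) ≤ γ / (1 + (a : ℝ) ^ τ) := fun a ha ha' => by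
    have h0 : (0 : ℝ) < a := by exact_mod_cast ha
    have h : (a : ℝ) ≤ 2 * m := by exact_mod_cast ha'
    gcongr
  refine (sum_inv_sq_le_of_separated _ (fun k => -k) _ hδ ?_ ?_).trans
    (four_div_sq_le hτ0.le hτ (by exact_mod_cast hm))
  · intro k hk
    obtain ⟨-, hpos, hle⟩ := Finset.mem_filter.1 hk
    obtain ⟨i, j, hij⟩ := hattained k
    rw [hij]
    exact (hmono _ hpos (by omega)).trans (h1 k hpos (by omega) i j)
  · intro k hk k' hk' hne hne'
    obtain ⟨-, -, hle⟩ := Finset.mem_filter.1 hk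
    obtain ⟨-, -, hle'⟩ := Finset.mem_filter.1 hk'
    obtain ⟨i, j, hij⟩ := hattained k
    obtain ⟨i', j', hij'⟩ := hattained k'
    have hsub : ∑ l, |(k - k') l| ≤ 2 * (m : ℤ) := by
      have : ∑ l, |(k - k') l| ≤ ∑ l, |k l| + ∑ l, |k' l| := by
        rw [← Finset.sum_add_distrib]
        exact Finset.sum_le_sum fun l _ => abs_sub _ _
      linarith
    have hadd : ∑ l, |(k + k') l| ≤ 2 * (m : ℤ) := by
      have : ∑ l, |(k + k') l| ≤ ∑ l, |k l| + ∑ l, |k' l| := by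
        rw [← Finset.sum_add_distrib]
        exact Finset.sum_le_sum fun l _ => abs_add_le _ _
      linarith
    have hsub0 : 0 < ∑ l, |(k - k') l| :=
      sum_abs_pos_of_ne_zero (sub_ne_zero.2 hne.symm)
    have hadd0 : 0 < ∑ l, |(k + k') l| :=
      sum_abs_pos_of_ne_zero fun h => hne' (eq_neg_of_add_eq_zero_right h)
    have hminus := (hmono _ hsub0 hsub).trans
      (h2 (k - k') hsub0 hsub i j i' j' (-1) 1 1 (-1) (by simp) (by simp) (by simp) (by simp))
    have hplus := (hmono _ hadd0 hadd).trans
      (h2 (k + k') hadd0 hadd i j i' j' (-1) 1 (-1) 1 (by simp) (by simp) (by simp) (by simp))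
    simp only [Pi.sub_apply, Pi.add_apply, Int.cast_sub, Int.cast_add, sub_mul, add_mul,
      Finset.sum_sub_distrib, Finset.sum_add_distrib] at hminus hplus
    rw [hij, hij']
    generalize γ / (1 + (2 * (m : ℝ)) ^ τ) = δ at hminus hplus ⊢
    generalize ∑ l, (k l : ℝ) * ω l = x at hminus hplus ⊢
    generalize ∑ l, (k' l : ℝ) * ω l = y at hminus hplus ⊢
    rw [le_abs] at hminus hplus ⊢
    rcases abs_cases (x - v i + v j) with ⟨h, -⟩ | ⟨h, -⟩ <;>
      rcases abs_cases (y - v i' + v j') with ⟨h', -⟩ | ⟨h', -⟩ <;>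
      rw [h, h'] <;> grind
end

section
/- Let n ≥ 1, let τ be a real number with 0 < τ ≤ n − 3/4, let γ > 0, let m ≥ 1 be an integer, let ω ∈ ℝⁿ and v = (v₁,…,v_d) ∈ ℝ^d. Assume: (i) for every k ∈ ℤⁿ with 0 < |k| ≤ 2m and all i, j ∈ {1,…,d}, |⟨k,ω⟩ − v_i + v_j| ≥ γ/(1 + |k|^τ); and (ii) for every k ∈ ℤⁿ with 0 < |k| ≤ 2m, all i, j, i', j' ∈ {1,…,d} and all sign choices ε₁,ε₂,ε₃,ε₄ ∈ {−1,+1}, |⟨k,ω⟩ + ε₁v_i + ε₂v_j + ε₃v_{i'} + ε₄v_{j'}| ≥ γ/(1 + |k|^τ). Define D_k(ω) = min_{1≤i,j≤d} |⟨k,ω⟩ − v_i + v_j|. Then ∑_{k ∈ ℤⁿ, 0 < |k| ≤ m} |k|² · D_k(ω)^{−4} ≤ 2^{4n+6} m^{4τ+2} / γ⁴. -/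
open Finset in
/-- A sum of inverse fourth powers of positive integers, each value taken at most twice,
is at most `4`. -/
theorem sum_inv_pow_four_le_four {ι : Type*} (S : Finset ι) (f : ι → ℕ)
    (hpos : ∀ a ∈ S, 0 < f a) (hfib : ∀ b, #{a ∈ S | f a = b} ≤ 2) :
    ∑ a ∈ S, ((f a : ℝ) ^ 4)⁻¹ ≤ 4 := by
  have hsub : S.image f ⊆ Ioo 0 (S.sup f + 1) := by
    intro b hb
    obtain ⟨a, ha, rfl⟩ := mem_image.1 hb
    exact mem_Ioo.2 ⟨hpos a ha, Nat.lt_succ_of_le (le_sup ha)⟩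
  calc ∑ a ∈ S, ((f a : ℝ) ^ 4)⁻¹
      = ∑ b ∈ S.image f, #{a ∈ S | f a = b} • ((b : ℝ) ^ 4)⁻¹ :=
        sum_comp (fun b : ℕ => ((b : ℝ) ^ 4)⁻¹) f
    _ ≤ ∑ b ∈ S.image f, 2 * ((b : ℝ) ^ 2)⁻¹ := by
        refine sum_le_sum fun b hb => ?_
        have hb1 : (1 : ℝ) ≤ b := by exact_mod_cast (mem_Ioo.1 (hsub hb)).1
        have hcard : (#{a ∈ S | f a = b} : ℝ) ≤ 2 := by exact_mod_cast hfib b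
        rw [nsmul_eq_mul]
        have hpow : (b : ℝ) ^ 2 ≤ (b : ℝ) ^ 4 := pow_le_pow_right₀ hb1 (by norm_num)
        gcongr
    _ ≤ ∑ b ∈ Ioo 0 (S.sup f + 1), 2 * ((b : ℝ) ^ 2)⁻¹ :=
        sum_le_sum_of_subset_of_nonneg hsub fun _ _ _ => by positivity
    _ ≤ 4 := by
        rw [← mul_sum]
        have h := sum_Ioo_inv_sq_le (α := ℝ) 0 (S.sup f + 1)
        norm_num at h
        linarith

open Finset in
/-- If a positive function is bounded below by `s > 0` and is `s`-separated up to the involution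
`k ↦ -k`, then the sum of its inverse fourth powers is at most `4 / s ^ 4`. -/
theorem sum_inv_pow_four_le_of_separated {ι : Type*} [InvolutiveNeg ι] (S : Finset ι) (D : ι → ℝ)
    {s : ℝ} (hs : 0 < s) (hD : ∀ k ∈ S, s ≤ D k)
    (hsep : ∀ k ∈ S, ∀ k' ∈ S, k ≠ k' → k ≠ -k' → s ≤ |D k - D k'|) :
    ∑ k ∈ S, (D k ^ 4)⁻¹ ≤ 4 * (s ^ 4)⁻¹ := by
  classical
  have hfloor : ∀ k ∈ S, 0 < ⌊D k / s⌋₊ := fun k hk =>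
    Nat.floor_pos.2 ((one_le_div hs).2 (hD k hk))
  have hfib : ∀ b, #{k ∈ S | ⌊D k / s⌋₊ = b} ≤ 2 := by
    intro b
    rcases eq_empty_or_nonempty {k ∈ S | ⌊D k / s⌋₊ = b} with h | ⟨k, hk⟩
    · simp [h]
    · refine (card_le_card (t := {k, -k}) fun k' hk' => ?_).trans card_le_two
      rw [mem_filter] at hk hk'
      by_contra hne
      simp only [mem_insert, mem_singleton, not_or] at hne
      have hdist := hsep k' hk'.1 k hk.1 hne.1 hne.2
      have bounds : ∀ j ∈ S, ⌊D j / s⌋₊ = b → b * s ≤ D j ∧ D j < (b + 1) * s := by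
        intro j hj hjb
        have := (Nat.floor_eq_iff (div_nonneg (hs.le.trans (hD j hj)) hs.le)).1 hjb
        exact ⟨(le_div_iff₀ hs).1 this.1, (div_lt_iff₀ hs).1 this.2⟩
      have b1 := bounds k hk.1 hk.2
      have b2 := bounds k' hk'.1 hk'.2
      exact absurd hdist (not_le.2 (abs_lt.2 ⟨by linarith, by linarith⟩))
  calc ∑ k ∈ S, (D k ^ 4)⁻¹
      ≤ ∑ k ∈ S, ((⌊D k / s⌋₊ : ℝ) ^ 4)⁻¹ * (s ^ 4)⁻¹ := by
        refine sum_le_sum fun k hk => ?_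
        have hpos : (0 : ℝ) < ⌊D k / s⌋₊ := by exact_mod_cast hfloor k hk
        have hle : (⌊D k / s⌋₊ : ℝ) * s ≤ D k :=
          (le_div_iff₀ hs).1 (Nat.floor_le (div_nonneg (hs.le.trans (hD k hk)) hs.le))
        rw [← mul_inv, ← mul_pow]
        gcongr
    _ ≤ 4 * (s ^ 4)⁻¹ := by
        rw [← sum_mul]
        gcongr
        exact sum_inv_pow_four_le_four S _ hfloor hfib


/-- Under Diophantine-type lower bounds on |⟨k,ω⟩ − v_i + v_j| and on second order
combinations, the sum of |k|²·D_k(ω)⁻⁴ over 0 < |k| ≤ m is at most 2^{4n+6} m^{4τ+2}/γ⁴. -/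
theorem stmt4 (n d : ℕ) (hn : 1 ≤ n) (hd : 1 ≤ d) (τ γ : ℝ)
    (hτ0 : 0 < τ) (hτ : τ ≤ (n : ℝ) - 3 / 4) (hγ : 0 < γ)
    (m : ℕ) (hm : 1 ≤ m) (ω : Fin n → ℝ) (v : Fin d → ℝ)
    (h1 : ∀ k : Fin n → ℤ, 0 < ∑ l, |k l| → ∑ l, |k l| ≤ 2 * (m : ℤ) →
      ∀ i j : Fin d,
        γ / (1 + (((∑ l, |k l| : ℤ) : ℝ)) ^ τ) ≤
          |(∑ l, (k l : ℝ) * ω l) - v i + v j|)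
    (h2 : ∀ k : Fin n → ℤ, 0 < ∑ l, |k l| → ∑ l, |k l| ≤ 2 * (m : ℤ) →
      ∀ i j i' j' : Fin d, ∀ e₁ e₂ e₃ e₄ : ℝ,
        (e₁ = 1 ∨ e₁ = -1) → (e₂ = 1 ∨ e₂ = -1) → (e₃ = 1 ∨ e₃ = -1) →
        (e₄ = 1 ∨ e₄ = -1) →
        γ / (1 + (((∑ l, |k l| : ℤ) : ℝ)) ^ τ) ≤
          |(∑ l, (k l : ℝ) * ω l) + e₁ * v i + e₂ * v j + e₃ * v i' + e₄ * v j'|) :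
    ∑ k ∈ (Finset.Icc (fun _ => -(m : ℤ)) fun _ => (m : ℤ)).filter
        (fun k : Fin n → ℤ => 0 < ∑ l, |k l| ∧ ∑ l, |k l| ≤ (m : ℤ)),
      ((∑ l, |k l| : ℤ) : ℝ) ^ 2 *
        ((⨅ i : Fin d, ⨅ j : Fin d, |(∑ l, (k l : ℝ) * ω l) - v i + v j|) ^ 4)⁻¹ ≤
      2 ^ (4 * n + 6) * (m : ℝ) ^ (4 * τ + 2) / γ ^ 4 := by
  classical
  have : Nonempty (Fin d) := ⟨⟨0, hd⟩⟩
  have hm' : (1 : ℝ) ≤ m := by exact_mod_cast hm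
  have hattained : ∀ k : Fin n → ℤ, ∃ i j : Fin d,
      |(∑ l, (k l : ℝ) * ω l) - v i + v j| =
        ⨅ i : Fin d, ⨅ j : Fin d, |(∑ l, (k l : ℝ) * ω l) - v i + v j| := by
    intro k
    obtain ⟨i, hi⟩ := exists_eq_ciInf_of_finite
      (f := fun i : Fin d => ⨅ j : Fin d, |(∑ l, (k l : ℝ) * ω l) - v i + v j|)
    obtain ⟨j, hj⟩ := exists_eq_ciInf_of_finite
      (f := fun j : Fin d => |(∑ l, (k l : ℝ) * ω l) - v i + v j|)
    exact ⟨i, j, hj.trans hi⟩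
  set D : (Fin n → ℤ) → ℝ := fun k =>
    ⨅ i : Fin d, ⨅ j : Fin d, |(∑ l, (k l : ℝ) * ω l) - v i + v j|
  set s : ℝ := γ / (1 + (2 * m : ℝ) ^ τ) with hs
  have hspos : 0 < s := by positivity
  have hsle : ∀ k : Fin n → ℤ, 0 < ∑ l, |k l| → ∑ l, |k l| ≤ 2 * (m : ℤ) →
      s ≤ γ / (1 + (((∑ l, |k l| : ℤ) : ℝ)) ^ τ) := by
    intro k hk0 hk
    have h0 : (0 : ℝ) < ((∑ l, |k l| : ℤ) : ℝ) := by exact_mod_cast hk0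
    have h2m : ((∑ l, |k l| : ℤ) : ℝ) ≤ 2 * m := by exact_mod_cast hk
    rw [hs]
    gcongr
  have hpos_of_ne : ∀ k : Fin n → ℤ, k ≠ 0 → 0 < ∑ l, |k l| := by
    intro k hk
    obtain ⟨l, hl⟩ := Function.ne_iff.1 hk
    exact Finset.sum_pos' (fun _ _ => abs_nonneg _) ⟨l, Finset.mem_univ l, abs_pos.2 hl⟩
  set S := (Finset.Icc (fun _ => -(m : ℤ)) fun _ => (m : ℤ)).filter
    (fun k : Fin n → ℤ => 0 < ∑ l, |k l| ∧ ∑ l, |k l| ≤ (m : ℤ))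
  have hmem : ∀ k ∈ S, 0 < ∑ l, |k l| ∧ ∑ l, |k l| ≤ (m : ℤ) := fun k hk =>
    (Finset.mem_filter.1 hk).2
  have hDs : ∀ k ∈ S, s ≤ D k := by
    intro k hk
    obtain ⟨hk0, hkm⟩ := hmem k hk
    obtain ⟨i, j, hij⟩ := hattained k
    have hk2 : ∑ l, |k l| ≤ 2 * (m : ℤ) := by omega
    exact ((hsle k hk0 hk2).trans (h1 k hk0 hk2 i j)).trans_eq hij
  have hsep : ∀ k ∈ S, ∀ k' ∈ S, k ≠ k' → k ≠ -k' → s ≤ |D k - D k'| := by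
    intro k hk k' hk' hne hne'
    obtain ⟨i, j, hij⟩ := hattained k
    obtain ⟨i', j', hij'⟩ := hattained k'
    have hkm := (hmem k hk).2
    have hkm' := (hmem k' hk').2
    have hsub : s ≤ |((∑ l, (k l : ℝ) * ω l) - v i + v j) -
        ((∑ l, (k' l : ℝ) * ω l) - v i' + v j')| := by
      have hp := hpos_of_ne (k - k') (sub_ne_zero.2 hne)
      have hle : ∑ l, |(k - k') l| ≤ 2 * (m : ℤ) :=
        calc ∑ l, |(k - k') l| ≤ ∑ l, (|k l| + |k' l|) :=
              Finset.sum_le_sum fun l _ => abs_sub (k l) (k' l)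
          _ ≤ 2 * (m : ℤ) := by rw [Finset.sum_add_distrib]; omega
      refine ((hsle _ hp hle).trans (h2 _ hp hle i j i' j' (-1) 1 1 (-1)
        (.inr rfl) (.inl rfl) (.inl rfl) (.inr rfl))).trans_eq ?_
      congr 1
      simp only [Pi.sub_apply, Int.cast_sub, sub_mul, Finset.sum_sub_distrib]
      ring
    have hadd : s ≤ |((∑ l, (k l : ℝ) * ω l) - v i + v j) +
        ((∑ l, (k' l : ℝ) * ω l) - v i' + v j')| := by
      have hp := hpos_of_ne (k + k') fun h => hne' (eq_neg_of_add_eq_zero_left h)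
      have hle : ∑ l, |(k + k') l| ≤ 2 * (m : ℤ) :=
        calc ∑ l, |(k + k') l| ≤ ∑ l, (|k l| + |k' l|) :=
              Finset.sum_le_sum fun l _ => abs_add_le (k l) (k' l)
          _ ≤ 2 * (m : ℤ) := by rw [Finset.sum_add_distrib]; omega
      refine ((hsle _ hp hle).trans (h2 _ hp hle i j i' j' (-1) 1 (-1) 1
        (.inr rfl) (.inl rfl) (.inr rfl) (.inl rfl))).trans_eq ?_
      congr 1
      simp only [Pi.add_apply, Int.cast_add, add_mul, Finset.sum_add_distrib]
      ring
    have hD : D k - D k' = |(∑ l, (k l : ℝ) * ω l) - v i + v j| -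
        |(∑ l, (k' l : ℝ) * ω l) - v i' + v j'| := by rw [hij, hij']
    rw [hD]
    generalize (∑ l, (k l : ℝ) * ω l) - v i + v j = a at *
    generalize (∑ l, (k' l : ℝ) * ω l) - v i' + v j' = b at *
    rcases abs_cases a with ha | ha <;> rcases abs_cases b with hb | hb <;> rw [ha.1, hb.1]
    · exact hsub
    · rwa [sub_neg_eq_add]
    · rwa [← abs_neg, neg_sub, sub_neg_eq_add, add_comm]
    · rwa [← abs_neg, show -(-a - -b) = a - b by ring]
  have hsinv : (s ^ 4)⁻¹ ≤ 2 ^ (4 * n + 4) * (m : ℝ) ^ (4 * τ) / γ ^ 4 := by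
    have hone : 1 ≤ (2 * m : ℝ) ^ τ := Real.one_le_rpow (by linarith) hτ0.le
    have htwo : ((2 : ℝ) ^ τ) ^ 4 ≤ 2 ^ (4 * n) := by
      rw [← Real.rpow_natCast, ← Real.rpow_mul (by norm_num), ← Real.rpow_natCast]
      refine Real.rpow_le_rpow_of_exponent_le (by norm_num) ?_
      push_cast
      linarith
    have hmpow : ((m : ℝ) ^ τ) ^ 4 = (m : ℝ) ^ (4 * τ) := by
      rw [← Real.rpow_natCast, ← Real.rpow_mul (by positivity), mul_comm]
      norm_num
    rw [hs, div_pow, inv_div]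
    gcongr
    calc (1 + (2 * m : ℝ) ^ τ) ^ 4 ≤ (2 * (2 * m : ℝ) ^ τ) ^ 4 := by
          gcongr
          linarith
      _ = 2 ^ 4 * ((2 : ℝ) ^ τ) ^ 4 * (m : ℝ) ^ (4 * τ) := by
          rw [Real.mul_rpow (by norm_num) (by positivity), mul_pow, mul_pow, hmpow]
          ring
      _ ≤ 2 ^ 4 * 2 ^ (4 * n) * (m : ℝ) ^ (4 * τ) := by gcongr
      _ = 2 ^ (4 * n + 4) * (m : ℝ) ^ (4 * τ) := by ring
  calc ∑ k ∈ S, ((∑ l, |k l| : ℤ) : ℝ) ^ 2 * (D k ^ 4)⁻¹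
      ≤ ∑ k ∈ S, (m : ℝ) ^ 2 * (D k ^ 4)⁻¹ := by
        refine Finset.sum_le_sum fun k hk => ?_
        obtain ⟨hk0, hkm⟩ := hmem k hk
        have h0 : (0 : ℝ) < ((∑ l, |k l| : ℤ) : ℝ) := by exact_mod_cast hk0
        have hle : ((∑ l, |k l| : ℤ) : ℝ) ≤ m := by exact_mod_cast hkm
        have hDpos := hspos.trans_le (hDs k hk)
        gcongr
    _ = (m : ℝ) ^ 2 * ∑ k ∈ S, (D k ^ 4)⁻¹ := by rw [Finset.mul_sum]
    _ ≤ (m : ℝ) ^ 2 * (4 * (2 ^ (4 * n + 4) * (m : ℝ) ^ (4 * τ) / γ ^ 4)) := by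
        gcongr
        exact (sum_inv_pow_four_le_of_separated S D hspos hDs hsep).trans (by gcongr)
    _ = 2 ^ (4 * n + 6) * (m : ℝ) ^ (4 * τ + 2) / γ ^ 4 := by
        rw [Real.rpow_add (by positivity), Real.rpow_two]
        ring
end

section
/- Let n ≥ 1, r > 0 and M > 0. Let f : ℂⁿ → ℂ be holomorphic on the open strip {x ∈ ℂⁿ : max_{1≤j≤n} |Im x_j| < r}, satisfy f(x + 2π e_j) = f(x) for every j and every x in the strip (where e_j is the j-th standard basis vector), and satisfy |f(x)| ≤ M for all x in the strip. For k ∈ ℤⁿ define the Fourier coefficient f̂(k) = (2π)^{−n} ∫_{[0,2π]ⁿ} f(x) e^{−i⟨k,x⟩} dx. Then ∑_{k ∈ ℤⁿ} |f̂(k)|² e^{2|k|r} ≤ 2ⁿ M². -/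
open MeasureTheory

/-- The open set of points of `ℂⁿ` all of whose coordinates have imaginary part less than `r` in
absolute value. -/
def imStrip (n : ℕ) (r : ℝ) : Set (Fin n → ℂ) := {x | ∀ j, |(x j).im| < r}

/-- Lebesgue measure on the cube `(0, 2π]ⁿ`. -/
noncomputable def periodCube (n : ℕ) : Measure (Fin n → ℝ) :=
  Measure.pi fun _ => volume.restrict (Set.Ioc 0 (2 * Real.pi))

instance (n : ℕ) : IsFiniteMeasure (periodCube n) := by
  unfold periodCube; infer_instance

theorem restrict_Icc_eq_periodCube (n : ℕ) :
    (volume : Measure (Fin n → ℝ)).restrict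
      (Set.Icc (fun _ => (0 : ℝ)) fun _ => 2 * Real.pi) = periodCube n := by
  rw [← Set.pi_univ_Icc, volume_pi, Measure.restrict_pi_pi, periodCube]
  congr 1
  funext i
  exact (Measure.restrict_congr_set Ioc_ae_eq_Icc).symm

theorem periodCube_real_univ (n : ℕ) : (periodCube n).real Set.univ = (2 * Real.pi) ^ n := by
  simp [periodCube, Measure.real, Measure.pi_univ, ENNReal.toReal_ofReal Real.pi_pos.le]

theorem isOpen_imStrip (n : ℕ) (r : ℝ) : IsOpen (imStrip n r) := by
  have : imStrip n r = ⋂ j, {x : Fin n → ℂ | |(x j).im| < r} := by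
    ext; simp [imStrip]
  rw [this]
  exact isOpen_iInter_of_finite fun j => isOpen_lt (by fun_prop) continuous_const

/-- The integral over a period of a periodic holomorphic function on a strip does not depend on
the height of the segment of integration. -/
theorem integral_period_add_mul_I_eq {r a b : ℝ} {F : ℂ → ℂ}
    (hF : DifferentiableOn ℂ F {z | |z.im| < r})
    (hper : ∀ z : ℂ, |z.im| < r → F (z + 2 * Real.pi) = F z) (ha : |a| < r) (hb : |b| < r) :
    ∫ x in (0 : ℝ)..2 * Real.pi, F (x + a * Complex.I) =
      ∫ x in (0 : ℝ)..2 * Real.pi, F (x + b * Complex.I) := by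
  have hsub : ∀ y ∈ Set.uIcc a b, |y| < r := by
    intro y hy
    rw [abs_lt] at *
    rcases Set.mem_uIcc.1 hy with h | h <;> constructor <;> linarith
  have h := Complex.integral_boundary_rect_eq_zero_of_differentiableOn F
    (⟨0, a⟩ : ℂ) (⟨2 * Real.pi, b⟩ : ℂ) (hF.mono fun z hz => hsub _ hz.2)
  have hv : ∫ y in a..b, F ((2 * Real.pi : ℝ) + y * Complex.I) =
      ∫ y in a..b, F ((0 : ℝ) + y * Complex.I) := by
    refine intervalIntegral.integral_congr fun y hy => ?_
    have := hper (y * Complex.I) (by simpa using hsub y hy)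
    simp only [Complex.ofReal_mul, Complex.ofReal_ofNat, Complex.ofReal_zero, zero_add]
    rw [add_comm, this]
  simp only [] at h
  rw [hv, add_sub_cancel_right, sub_eq_zero] at h
  exact h

theorem mem_imStrip_add_mul_I {n : ℕ} {r : ℝ} {y : Fin n → ℝ} (hy : ∀ j, |y j| < r)
    (x : Fin n → ℝ) : (fun i => (x i : ℂ) + y i * Complex.I) ∈ imStrip n r := by
  intro j; simpa using hy j

theorem continuous_comp_add_mul_I {n : ℕ} {r : ℝ} {G : (Fin n → ℂ) → ℂ}
    (hG : ContinuousOn G (imStrip n r)) {y : Fin n → ℝ} (hy : ∀ j, |y j| < r) :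
    Continuous fun x : Fin n → ℝ => G fun i => (x i : ℂ) + y i * Complex.I :=
  hG.comp_continuous (by fun_prop) (mem_imStrip_add_mul_I hy)

theorem integrable_periodCube {n : ℕ} {g : (Fin n → ℝ) → ℂ} (hg : Continuous g) :
    Integrable g (periodCube n) := by
  rw [← restrict_Icc_eq_periodCube]
  exact hg.continuousOn.integrableOn_compact isCompact_Icc

theorem integral_periodCube_update {n : ℕ} {r : ℝ} {G : (Fin n → ℂ) → ℂ}
    (hG : DifferentiableOn ℂ G (imStrip n r))
    (hper : ∀ j, ∀ x ∈ imStrip n r, G (x + Pi.single j (2 * Real.pi : ℂ)) = G x)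
    {y : Fin n → ℝ} (hy : ∀ j, |y j| < r) (j : Fin n) {b : ℝ} (hb : |b| < r) :
    ∫ x, G (fun i => (x i : ℂ) + (Function.update y j b i : ℝ) * Complex.I) ∂periodCube n =
      ∫ x, G (fun i => (x i : ℂ) + y i * Complex.I) ∂periodCube n := by
  obtain _ | m := n
  · exact j.elim0
  have hy' : ∀ i, |Function.update y j b i| < r := by
    intro i
    rcases eq_or_ne i j with rfl | h
    · simpa using hb
    · simpa [h] using hy i
  have fubini : ∀ w : Fin (m + 1) → ℝ, (∀ i, |w i| < r) →
      ∫ x, G (fun i => (x i : ℂ) + w i * Complex.I) ∂periodCube (m + 1) =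
      ∫ x' : Fin m → ℝ, (∫ t in (0 : ℝ)..2 * Real.pi,
        G (j.insertNth ((t : ℂ) + w j * Complex.I)
          fun i => (x' i : ℂ) + w (j.succAbove i) * Complex.I)) ∂periodCube m := by
    intro w hw
    have mp := (measurePreserving_piFinSuccAbove
      (fun _ : Fin (m + 1) => volume.restrict (Set.Ioc (0 : ℝ) (2 * Real.pi))) j).symm
    have hi := integrable_periodCube (continuous_comp_add_mul_I hG.continuousOn hw)
    have hi' := (mp.integrable_comp_emb (MeasurableEquiv.measurableEmbedding _)).2 hi
    have h1 := mp.integral_comp' (fun x => G (fun i => (x i : ℂ) + w i * Complex.I))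
    rw [periodCube, ← h1]
    refine (integral_prod_symm _ hi').trans ?_
    refine integral_congr_ae (Filter.Eventually.of_forall fun x' => ?_)
    simp only []
    rw [intervalIntegral.integral_of_le (by positivity)]
    refine integral_congr_ae (Filter.Eventually.of_forall fun t => ?_)
    simp only [Function.comp, MeasurableEquiv.piFinSuccAbove_symm_apply, Fin.insertNthEquiv,
      Equiv.coe_fn_mk]
    congr 1
    funext i
    refine Fin.succAboveCases j ?_ (fun i => ?_) i <;> simp
  rw [fubini _ hy', fubini _ hy]
  refine integral_congr_ae (Filter.Eventually.of_forall fun x' => ?_)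
  simp only [Function.update_self, Function.update_of_ne (Fin.succAbove_ne j _)]
  have hmem : ∀ z : ℂ, |z.im| < r → (j.insertNth z
      (fun i => (x' i : ℂ) + y (j.succAbove i) * Complex.I) : Fin (m + 1) → ℂ)
        ∈ imStrip (m + 1) r := by
    intro z hz i
    refine Fin.succAboveCases j ?_ (fun i => ?_) i
    · simpa using hz
    · simpa using hy _
  refine integral_period_add_mul_I_eq (F := fun z => G (j.insertNth z
      fun i => (x' i : ℂ) + y (j.succAbove i) * Complex.I)) ?_ ?_ hb (hy j)
  · refine hG.comp (fun z _ => DifferentiableAt.differentiableWithinAt ?_) hmem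
    rw [differentiableAt_pi]
    intro i
    refine Fin.succAboveCases j ?_ (fun i => ?_) i
    · simp
    · simp
  · intro z hz
    rw [← hper j _ (hmem z hz)]
    congr 1
    funext i
    refine Fin.succAboveCases j ?_ (fun i => ?_) i <;> simp [Fin.succAbove_ne]

theorem integral_periodCube_add_mul_I {n : ℕ} {r : ℝ} (hr : 0 < r) {G : (Fin n → ℂ) → ℂ}
    (hG : DifferentiableOn ℂ G (imStrip n r))
    (hper : ∀ j, ∀ x ∈ imStrip n r, G (x + Pi.single j (2 * Real.pi : ℂ)) = G x)
    {y : Fin n → ℝ} (hy : ∀ j, |y j| < r) :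
    ∫ x, G (fun i => (x i : ℂ) + y i * Complex.I) ∂periodCube n =
      ∫ x, G (fun i => (x i : ℂ)) ∂periodCube n := by
  classical
  have key : ∀ S : Finset (Fin n),
      ∫ x, G (fun i => (x i : ℂ) + (S.piecewise y 0 i : ℝ) * Complex.I) ∂periodCube n =
        ∫ x, G (fun i => (x i : ℂ)) ∂periodCube n := by
    intro S
    induction S using Finset.induction_on with
    | empty => simp
    | insert j S _ ih =>
      rw [Finset.piecewise_insert, integral_periodCube_update hG hper _ _ (hy j), ih]
      intro i
      by_cases h : i ∈ S
      · simpa [h] using hy i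
      · simpa [h] using hr
  simpa using key Finset.univ

theorem integral_Ioc_exp_int_mul (m : ℤ) :
    ∫ t in Set.Ioc (0 : ℝ) (2 * Real.pi), Complex.exp (Complex.I * ((m * t : ℝ) : ℂ)) =
      if m = 0 then (2 * Real.pi : ℂ) else 0 := by
  rw [← intervalIntegral.integral_of_le (by positivity)]
  split_ifs with h
  · simp [h]
  · have hc : Complex.I * m ≠ 0 := by simp [h]
    have h1 := integral_exp_mul_complex (a := 0) (b := 2 * Real.pi) hc
    have h2 : Complex.exp (Complex.I * m * (2 * Real.pi : ℝ)) = 1 := by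
      rw [← Complex.exp_int_mul_two_pi_mul_I m]
      congr 1
      push_cast
      ring
    rw [h2] at h1
    simpa [mul_assoc] using h1

theorem integral_periodCube_exp {n : ℕ} (k : Fin n → ℤ) :
    ∫ x, Complex.exp (Complex.I * ((∑ i, (k i : ℝ) * x i : ℝ) : ℂ)) ∂periodCube n =
      if k = 0 then (2 * Real.pi : ℂ) ^ n else 0 := by
  simp only [Complex.ofReal_sum, Finset.mul_sum, Complex.exp_sum]
  rw [periodCube, integral_fintype_prod_eq_prod
    (f := fun i (t : ℝ) => Complex.exp (Complex.I * ((k i * t : ℝ) : ℂ)))]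
  simp only [integral_Ioc_exp_int_mul]
  split_ifs with h
  · simp [h]
  · obtain ⟨i, hi⟩ := Function.ne_iff.1 h
    exact Finset.prod_eq_zero (Finset.mem_univ i) (if_neg hi)

/-- Bessel's inequality for multiple Fourier series. -/
theorem sum_sq_norm_fourier_le {n : ℕ} {M : ℝ} {g : (Fin n → ℝ) → ℂ}
    (hg : Continuous g) (hM : ∀ x, ‖g x‖ ≤ M) (S : Finset (Fin n → ℤ)) :
    ∑ k ∈ S, ‖((2 * Real.pi : ℂ) ^ n)⁻¹ *
      ∫ x, g x * Complex.exp (-Complex.I * ((∑ i, (k i : ℝ) * x i : ℝ) : ℂ)) ∂periodCube n‖ ^ 2 ≤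
      M ^ 2 := by
  classical
  set V : ℝ := (2 * Real.pi) ^ n with hV
  have hVpos : 0 < V := by positivity
  set c : ℝ := (√V)⁻¹ with hc
  have hcc : c * c = V⁻¹ := by rw [hc, ← mul_inv, Real.mul_self_sqrt hVpos.le]
  let e : (Fin n → ℤ) → (Fin n → ℝ) → ℂ := fun k x =>
    c * Complex.exp (Complex.I * ((∑ i, (k i : ℝ) * x i : ℝ) : ℂ))
  have conj_e : ∀ k x, (starRingEnd ℂ) (e k x) =
      c * Complex.exp (-Complex.I * ((∑ i, (k i : ℝ) * x i : ℝ) : ℂ)) := by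
    intro k x
    simp only [e, map_mul, Complex.conj_ofReal, ← Complex.exp_conj, Complex.conj_I]
  have he : ∀ k, MemLp (e k) 2 (periodCube n) := by
    intro k
    refine MemLp.of_bound (Continuous.aestronglyMeasurable (by fun_prop)) |c|
      (Filter.Eventually.of_forall fun x => ?_)
    simp only [e, norm_mul, mul_comm Complex.I, Complex.norm_exp_ofReal_mul_I]
    simp
  have hg2 : MemLp g 2 (periodCube n) :=
    MemLp.of_bound hg.aestronglyMeasurable M (Filter.Eventually.of_forall hM)
  have hinner : ∀ {u v : (Fin n → ℝ) → ℂ} (hu : MemLp u 2 (periodCube n))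
      (hv : MemLp v 2 (periodCube n)),
      inner ℂ (hu.toLp u) (hv.toLp v) = ∫ x, v x * (starRingEnd ℂ) (u x) ∂periodCube n := by
    intro u v hu hv
    rw [L2.inner_def]
    refine integral_congr_ae ?_
    filter_upwards [hu.coeFn_toLp, hv.coeFn_toLp] with x h1 h2
    rw [h1, h2]
    rfl
  have horth : Orthonormal ℂ fun k => (he k).toLp (e k) := by
    rw [orthonormal_iff_ite]
    intro k l
    rw [hinner]
    have : ∀ x, e l x * (starRingEnd ℂ) (e k x) = ((V⁻¹ : ℝ) : ℂ) *
        Complex.exp (Complex.I * ((∑ i, ((l - k) i : ℤ) * x i : ℝ) : ℂ)) := by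
      intro x
      rw [conj_e, ← hcc]
      simp only [e]
      rw [mul_mul_mul_comm, ← Complex.exp_add, Complex.ofReal_mul]
      congr 2
      simp only [Pi.sub_apply, Int.cast_sub, sub_mul, Finset.sum_sub_distrib]
      push_cast
      ring
    simp only [this]
    rw [integral_const_mul, integral_periodCube_exp]
    simp only [sub_eq_zero, eq_comm (a := k)]
    split_ifs
    · rw [hV]
      push_cast
      exact inv_mul_cancel₀ (by simp [Real.pi_ne_zero])
    · simp
  have bessel := horth.sum_inner_products_le (hg2.toLp g) (s := S)
  have hnorm : ‖hg2.toLp g‖ ^ 2 ≤ V * M ^ 2 := by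
    have h1 : ((‖hg2.toLp g‖ ^ 2 : ℝ) : ℂ) = ((∫ x, ‖g x‖ ^ 2 ∂periodCube n : ℝ) : ℂ) := by
      have := inner_self_eq_norm_sq_to_K (𝕜 := ℂ) (hg2.toLp g)
      rw [hinner] at this
      simp only [Complex.mul_conj, Complex.normSq_eq_norm_sq] at this
      rw [← integral_complex_ofReal, this]
      simp
    rw [Complex.ofReal_inj] at h1
    rw [h1]
    calc ∫ x, ‖g x‖ ^ 2 ∂periodCube n ≤ ∫ _, M ^ 2 ∂periodCube n := by
          refine integral_mono_of_nonneg (Filter.Eventually.of_forall fun x => by positivity)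
            (integrable_const _) (Filter.Eventually.of_forall fun x => ?_)
          exact pow_le_pow_left₀ (norm_nonneg _) (hM x) 2
      _ = V * M ^ 2 := by rw [integral_const, periodCube_real_univ, smul_eq_mul]
  have hterm : ∀ k, ‖((2 * Real.pi : ℂ) ^ n)⁻¹ *
      ∫ x, g x * Complex.exp (-Complex.I * ((∑ i, (k i : ℝ) * x i : ℝ) : ℂ)) ∂periodCube n‖ ^ 2 =
      V⁻¹ * ‖inner ℂ ((he k).toLp (e k)) (hg2.toLp g)‖ ^ 2 := by
    intro k
    rw [hinner]
    simp only [conj_e, mul_left_comm _ (c : ℂ)]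
    rw [integral_const_mul, norm_mul, norm_mul (c : ℂ), Complex.norm_real, mul_pow, mul_pow ‖c‖,
      Real.norm_eq_abs, sq_abs, sq c, hcc, ← mul_assoc]
    congr 1
    have : ((2 * Real.pi : ℂ) ^ n)⁻¹ = ((V⁻¹ : ℝ) : ℂ) := by rw [hV]; push_cast; rfl
    rw [this, Complex.norm_real, Real.norm_eq_abs, sq_abs, sq]
  simp only [hterm, ← Finset.mul_sum]
  calc _ ≤ V⁻¹ * (V * M ^ 2) := by gcongr; exact bessel.trans hnorm
    _ = M ^ 2 := by field_simp

/-- Moving the cube of integration in the imaginary direction `y` multiplies the `k`-th Fourier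
coefficient by `exp (-⟨k, y⟩)`. -/
theorem integral_fourier_add_mul_I {n : ℕ} {r : ℝ} (hr : 0 < r) {f : (Fin n → ℂ) → ℂ}
    (hf : DifferentiableOn ℂ f (imStrip n r))
    (hper : ∀ j, ∀ x ∈ imStrip n r, f (x + Pi.single j (2 * Real.pi : ℂ)) = f x)
    {y : Fin n → ℝ} (hy : ∀ j, |y j| < r) (k : Fin n → ℤ) :
    (∫ x, f (fun i => (x i : ℂ) + y i * Complex.I) *
        Complex.exp (-Complex.I * ((∑ i, (k i : ℝ) * x i : ℝ) : ℂ)) ∂periodCube n) =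
      Real.exp (-∑ i, k i * y i) * ∫ x, f (fun i => (x i : ℂ)) *
        Complex.exp (-Complex.I * ((∑ i, (k i : ℝ) * x i : ℝ) : ℂ)) ∂periodCube n := by
  have h := integral_periodCube_add_mul_I hr
    (G := fun z => f z * Complex.exp (-Complex.I * ∑ i, (k i : ℂ) * z i))
    (hf.mul (Differentiable.differentiableOn (by fun_prop))) ?_ hy
  · push_cast at h ⊢
    rw [← h, ← integral_const_mul]
    refine integral_congr_ae (Filter.Eventually.of_forall fun x => ?_)
    simp only []
    rw [mul_left_comm, ← Complex.exp_add]
    congr 2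
    simp only [mul_add, Finset.sum_add_distrib]
    simp only [← mul_assoc, ← Finset.sum_mul]
    linear_combination (∑ i, (k i : ℂ) * y i) * Complex.I_mul_I
  · intro j x hx
    simp only [hper j x hx]
    congr 1
    rw [← Complex.exp_periodic.int_mul (k j)]
    congr 1
    simp only [Pi.add_apply, mul_add, Finset.sum_add_distrib, Pi.single_apply, mul_ite, mul_zero,
      Finset.sum_ite_eq', Finset.mem_univ, if_true]
    ring

theorem sum_sq_norm_fourier_mul_exp_le {n : ℕ} {r M ρ : ℝ} (hρ : 0 ≤ ρ) (hρr : ρ < r)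
    {f : (Fin n → ℂ) → ℂ} (hf : DifferentiableOn ℂ f (imStrip n r))
    (hper : ∀ j, ∀ x ∈ imStrip n r, f (x + Pi.single j (2 * Real.pi : ℂ)) = f x)
    (hbound : ∀ x ∈ imStrip n r, ‖f x‖ ≤ M) (S : Finset (Fin n → ℤ)) :
    ∑ k ∈ S, ‖((2 * Real.pi : ℂ) ^ n)⁻¹ * ∫ x, f (fun i => (x i : ℂ)) *
        Complex.exp (-Complex.I * ((∑ i, (k i : ℝ) * x i : ℝ) : ℂ)) ∂periodCube n‖ ^ 2 *
          Real.exp (2 * ((∑ i, |k i| : ℤ) : ℝ) * ρ) ≤ 2 ^ n * M ^ 2 := by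
  let y : (Fin n → Bool) → Fin n → ℝ := fun s i => if s i then ρ else -ρ
  have hy : ∀ s j, |y s j| < r := by
    intro s j
    simp only [y]
    split_ifs <;> simpa [abs_of_nonneg hρ] using hρr
  let B : (Fin n → Bool) → (Fin n → ℤ) → ℝ := fun s k => ‖((2 * Real.pi : ℂ) ^ n)⁻¹ *
    ∫ x, f (fun i => (x i : ℂ) + y s i * Complex.I) *
      Complex.exp (-Complex.I * ((∑ i, (k i : ℝ) * x i : ℝ) : ℂ)) ∂periodCube n‖ ^ 2
  calc _ ≤ ∑ k ∈ S, ∑ s, B s k := by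
        refine Finset.sum_le_sum fun k _ => ?_
        let s : Fin n → Bool := fun i => decide (k i < 0)
        refine le_trans (le_of_eq ?_)
          (Finset.single_le_sum (f := fun s => B s k) (fun s _ => sq_nonneg _) (Finset.mem_univ s))
        simp only [B]
        rw [integral_fourier_add_mul_I (hρ.trans_lt hρr) hf hper (hy s), mul_left_comm,
          norm_mul (Complex.ofReal _), Complex.norm_real, Real.norm_eq_abs, Real.abs_exp,
          mul_pow (Real.exp _), mul_comm, ← Real.exp_nat_mul]
        congr 2
        push_cast
        rw [mul_assoc, Finset.sum_mul, ← Finset.sum_neg_distrib]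
        congr 1
        refine Finset.sum_congr rfl fun i _ => ?_
        by_cases h : k i < 0
        · have : (k i : ℝ) < 0 := by exact_mod_cast h
          simp [y, s, h, abs_of_neg this]
        · have : 0 ≤ (k i : ℝ) := by exact_mod_cast not_lt.1 h
          simp [y, s, h, abs_of_nonneg this]
    _ = ∑ s, ∑ k ∈ S, B s k := Finset.sum_comm
    _ ≤ ∑ _s : Fin n → Bool, M ^ 2 := Finset.sum_le_sum fun s _ =>
        sum_sq_norm_fourier_le (continuous_comp_add_mul_I hf.continuousOn (hy s))
          (fun x => hbound _ (mem_imStrip_add_mul_I (hy s) x)) S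
    _ = 2 ^ n * M ^ 2 := by simp

/-- Rüssmann's lemma: if f is holomorphic, 2π-periodic in each variable and bounded by M
on the strip of width r, then ∑_k |f̂(k)|² e^{2|k|r} ≤ 2ⁿ M². -/
theorem stmt5 (n : ℕ) (hn : 1 ≤ n) (r M : ℝ) (hr : 0 < r) (hM : 0 < M)
    (f : (Fin n → ℂ) → ℂ)
    (hf : DifferentiableOn ℂ f {x : Fin n → ℂ | ∀ j, |(x j).im| < r})
    (hper : ∀ j : Fin n, ∀ x ∈ {x : Fin n → ℂ | ∀ j, |(x j).im| < r},
      f (x + Pi.single j (2 * Real.pi : ℂ)) = f x)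
    (hbound : ∀ x ∈ {x : Fin n → ℂ | ∀ j, |(x j).im| < r}, ‖f x‖ ≤ M) :
    ∑' k : Fin n → ℤ,
        ENNReal.ofReal
          (‖((2 * Real.pi : ℂ) ^ n)⁻¹ *
              ∫ x in Set.Icc (fun _ => (0 : ℝ)) fun _ => 2 * Real.pi,
                f (fun i => (x i : ℂ)) *
                  Complex.exp (-Complex.I * ((∑ i, (k i : ℝ) * x i : ℝ) : ℂ))‖ ^ 2 *
            Real.exp (2 * ((∑ i, |k i| : ℤ) : ℝ) * r)) ≤
      ENNReal.ofReal (2 ^ n * M ^ 2) := by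
  rw [ENNReal.tsum_eq_iSup_sum]
  refine iSup_le fun S => ?_
  rw [← ENNReal.ofReal_sum_of_nonneg fun k _ => by positivity]
  refine ENNReal.ofReal_le_ofReal ?_
  simp only [restrict_Icc_eq_periodCube]
  have hlim : Filter.Tendsto (fun ρ : ℝ => ∑ k ∈ S, ‖((2 * Real.pi : ℂ) ^ n)⁻¹ *
      ∫ x, f (fun i => (x i : ℂ)) *
        Complex.exp (-Complex.I * ((∑ i, (k i : ℝ) * x i : ℝ) : ℂ)) ∂periodCube n‖ ^ 2 *
          Real.exp (2 * ((∑ i, |k i| : ℤ) : ℝ) * ρ)) (nhdsWithin r (Set.Iio r))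
      (nhds (∑ k ∈ S, ‖((2 * Real.pi : ℂ) ^ n)⁻¹ *
      ∫ x, f (fun i => (x i : ℂ)) *
        Complex.exp (-Complex.I * ((∑ i, (k i : ℝ) * x i : ℝ) : ℂ)) ∂periodCube n‖ ^ 2 *
          Real.exp (2 * ((∑ i, |k i| : ℤ) : ℝ) * r))) :=
    Filter.Tendsto.mono_left (Continuous.tendsto (by fun_prop) r) nhdsWithin_le_nhds
  refine le_of_tendsto hlim ?_
  filter_upwards [Ioo_mem_nhdsLT hr] with ρ hρ
  exact sum_sq_norm_fourier_mul_exp_le hρ.1.le hρ.2 hf hper hbound S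
end

section
/- Let φ : [0,∞) → ℝ be continuous, nonnegative and nondecreasing (0 ≤ φ(s) ≤ φ(t) whenever 0 ≤ s ≤ t), and assume lim_{s→∞} s^{−1} log φ(s) = 0. Let (a_j)_{j≥0} be a sequence of nonnegative real numbers such that ∑_{j=0}^{m} a_j ≤ φ(m) for every integer m ≥ 0. Then for every δ > 0 the series ∑_{j=0}^{∞} a_j e^{−δj} converges and ∑_{j=0}^{∞} a_j e^{−δj} ≤ ∫_{0}^{∞} e^{−s} φ(s/δ) ds < ∞. -/
open MeasureTheory

/-- The tail integral of `c * exp (-s)` beyond `t`, as a Lebesgue integral in `ℝ≥0∞`. -/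
lemma lintegral_Ioi_ofReal_mul_exp_neg {c : ℝ} (hc : 0 ≤ c) (t : ℝ) :
    ∫⁻ s in Set.Ioi t, ENNReal.ofReal (c * Real.exp (-s)) =
      ENNReal.ofReal (c * Real.exp (-t)) := by
  have hint : IntegrableOn (fun s : ℝ => c * Real.exp (-s)) (Set.Ioi t) := by
    simpa [IntegrableOn] using (exp_neg_integrableOn_Ioi t one_pos).const_mul c
  rw [← ofReal_integral_eq_lintegral_ofReal hint
    (Filter.Eventually.of_forall fun s => mul_nonneg hc (Real.exp_pos _).le),
    integral_const_mul, integral_exp_neg_Ioi]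

/-- A nonnegative sequence whose partial sums are bounded by a nondecreasing function `φ` satisfies
`∑ a_j e^{-δj} ≤ ∫₀^∞ e^{-s} φ(s/δ) ds`, both sides being possibly infinite. -/
lemma tsum_ofReal_mul_exp_le_lintegral {φ : ℝ → ℝ}
    (hmono : ∀ s t : ℝ, 0 ≤ s → s ≤ t → φ s ≤ φ t) {a : ℕ → ℝ} (ha : ∀ j, 0 ≤ a j)
    (hsum : ∀ m : ℕ, ∑ j ∈ Finset.range (m + 1), a j ≤ φ m) {δ : ℝ} (hδ : 0 < δ) :
    ∑' j : ℕ, ENNReal.ofReal (a j * Real.exp (-δ * j)) ≤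
      ∫⁻ s in Set.Ioi (0 : ℝ), ENNReal.ofReal (Real.exp (-s) * φ (s / δ)) := by
  have hterm (j : ℕ) : ENNReal.ofReal (a j * Real.exp (-δ * j)) =
      ∫⁻ s in Set.Ioi (0 : ℝ), (Set.Ioi (δ * j)).indicator
        (fun s => ENNReal.ofReal (a j * Real.exp (-s))) s := by
    rw [setLIntegral_indicator measurableSet_Ioi, Set.Ioi_inter_Ioi,
      sup_eq_left.2 (by positivity : (0 : ℝ) ≤ δ * j),
      lintegral_Ioi_ofReal_mul_exp_neg (ha j), neg_mul]
  simp_rw [hterm]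
  rw [← lintegral_tsum fun j =>
    ((by fun_prop : Measurable fun s : ℝ => ENNReal.ofReal (a j * Real.exp (-s))).indicator
      measurableSet_Ioi).aemeasurable]
  refine setLIntegral_mono' measurableSet_Ioi fun s hs => ?_
  have hs' : 0 ≤ s / δ := div_nonneg (le_of_lt hs) hδ.le
  rw [tsum_eq_sum (s := Finset.range (⌊s / δ⌋₊ + 1))]
  · calc ∑ j ∈ Finset.range (⌊s / δ⌋₊ + 1), (Set.Ioi (δ * j)).indicator
          (fun s => ENNReal.ofReal (a j * Real.exp (-s))) s
        ≤ ∑ j ∈ Finset.range (⌊s / δ⌋₊ + 1), ENNReal.ofReal (a j * Real.exp (-s)) :=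
          Finset.sum_le_sum fun j _ => Set.indicator_le_self _ _ _
      _ = ENNReal.ofReal (Real.exp (-s) * ∑ j ∈ Finset.range (⌊s / δ⌋₊ + 1), a j) := by
          rw [← ENNReal.ofReal_sum_of_nonneg fun j _ => mul_nonneg (ha j) (Real.exp_pos _).le,
            ← Finset.sum_mul, mul_comm]
      _ ≤ ENNReal.ofReal (Real.exp (-s) * φ (s / δ)) := by
          gcongr
          exact (hsum _).trans (hmono _ _ (Nat.cast_nonneg _) (Nat.floor_le hs'))
  · intro j hj
    refine Set.indicator_of_notMem (fun h => hj ?_) _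
    rw [Finset.mem_range, Nat.lt_succ_iff, Nat.le_floor_iff hs', le_div_iff₀ hδ, mul_comm]
    exact le_of_lt h

/-- A nondecreasing function of subexponential growth is Laplace integrable at every scale. -/
lemma lintegral_exp_neg_mul_lt_top {φ : ℝ → ℝ} (hnonneg : ∀ s : ℝ, 0 ≤ s → 0 ≤ φ s)
    (hmono : ∀ s t : ℝ, 0 ≤ s → s ≤ t → φ s ≤ φ t)
    (hlim : Filter.Tendsto (fun s => Real.log (φ s) / s) Filter.atTop (nhds 0))
    {δ : ℝ} (hδ : 0 < δ) :
    ∫⁻ s in Set.Ioi (0 : ℝ), ENNReal.ofReal (Real.exp (-s) * φ (s / δ)) < ⊤ := by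
  obtain ⟨U, hU⟩ := Filter.eventually_atTop.1
    ((hlim.eventually_lt_const (half_pos hδ)).and (Filter.eventually_gt_atTop 0))
  have hUpos : 0 < U := (hU U le_rfl).2
  have hφ (u : ℝ) (hu : U ≤ u) : φ u ≤ Real.exp (δ / 2 * u) := by
    rcases (hnonneg u (hUpos.le.trans hu)).eq_or_lt with h | h
    · rw [← h]
      positivity
    · rw [← Real.log_le_iff_le_exp h]
      exact ((div_lt_iff₀ (hU u hu).2).1 (hU u hu).1).le
  have hint : IntegrableOn (fun s : ℝ => Real.exp (δ / 2 * U) * Real.exp (-(1 / 2) * s))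
      (Set.Ioi 0) := (exp_neg_integrableOn_Ioi 0 one_half_pos).const_mul _
  refine lt_of_le_of_lt (setLIntegral_mono' measurableSet_Ioi fun s hs => ?_)
    hint.lintegral_lt_top
  have hs0 : 0 < s := hs
  refine ENNReal.ofReal_le_ofReal ?_
  have hsδ : 0 < s / δ := div_pos hs0 hδ
  calc Real.exp (-s) * φ (s / δ)
      ≤ Real.exp (-s) * Real.exp (δ / 2 * (s / δ + U)) := by
        gcongr
        exact (hmono _ _ hsδ.le (by linarith)).trans (hφ _ (by linarith))
    _ = Real.exp (δ / 2 * U) * Real.exp (-(1 / 2) * s) := by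
        rw [← Real.exp_add, ← Real.exp_add]
        congr 1
        field_simp
        ring

/-- Rüssmann's summation lemma: if partial sums of the nonnegative sequence a are bounded by a
nondecreasing subexponential function φ, then for every δ > 0,
∑ a_j e^{−δj} ≤ ∫₀^∞ e^{−s} φ(s/δ) ds < ∞. -/
theorem stmt6 (φ : ℝ → ℝ) (hcont : ContinuousOn φ (Set.Ici 0))
    (hnonneg : ∀ s : ℝ, 0 ≤ s → 0 ≤ φ s)
    (hmono : ∀ s t : ℝ, 0 ≤ s → s ≤ t → φ s ≤ φ t)
    (hlim : Filter.Tendsto (fun s => Real.log (φ s) / s) Filter.atTop (nhds 0))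
    (a : ℕ → ℝ) (ha : ∀ j, 0 ≤ a j)
    (hsum : ∀ m : ℕ, ∑ j ∈ Finset.range (m + 1), a j ≤ φ m) :
    ∀ δ : ℝ, 0 < δ →
      (∑' j : ℕ, ENNReal.ofReal (a j * Real.exp (-δ * j)) ≤
          ∫⁻ s in Set.Ioi (0 : ℝ), ENNReal.ofReal (Real.exp (-s) * φ (s / δ))) ∧
      (∫⁻ s in Set.Ioi (0 : ℝ), ENNReal.ofReal (Real.exp (-s) * φ (s / δ))) < ⊤ := by
  intro δ hδ
  exact ⟨tsum_ofReal_mul_exp_le_lintegral hmono ha hsum hδ,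
    lintegral_exp_neg_mul_lt_top hnonneg hmono hlim hδ⟩
end

section
/- Let τ > 0 and C ≥ 0, and let (a_j)_{j≥0} be a sequence of nonnegative real numbers such that ∑_{j=0}^{m} a_j ≤ C m^{2τ} for every integer m ≥ 0. Then for every δ > 0, ∑_{j=0}^{∞} a_j e^{−δj} ≤ C · Γ(2τ+1) / δ^{2τ}, where Γ is the Gamma function. -/
open MeasureTheory in
lemma ofReal_exp_neg_mul_eq_lintegral {δ : ℝ} (hδ : 0 < δ) (c : ℝ) :
    ENNReal.ofReal (Real.exp (-δ * c)) =
      ∫⁻ t in Set.Ioi c, ENNReal.ofReal (δ * Real.exp (-δ * t)) := by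
  have hneg : -δ < 0 := neg_lt_zero.mpr hδ
  rw [← ofReal_integral_eq_lintegral_ofReal ((integrableOn_exp_mul_Ioi hneg c).const_mul δ)
    (Filter.Eventually.of_forall fun t ↦ by positivity), integral_const_mul,
    integral_exp_mul_Ioi hneg]
  congr 1
  field_simp

open MeasureTheory in
lemma lintegral_rpow_mul_exp_density {δ s : ℝ} (hδ : 0 < δ) (hs : -1 < s) :
    ∫⁻ t in Set.Ioi 0, ENNReal.ofReal (t ^ s * (δ * Real.exp (-δ * t))) =
      ENNReal.ofReal (Real.Gamma (s + 1) / δ ^ s) := by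
  have hint : IntegrableOn (fun t : ℝ ↦ t ^ s * (δ * Real.exp (-δ * t))) (Set.Ioi 0) := by
    have h := (integrableOn_rpow_mul_exp_neg_mul_rpow hs one_pos hδ).const_mul δ
    simpa only [IntegrableOn, Real.rpow_one, mul_left_comm] using h
  rw [← ofReal_integral_eq_lintegral_ofReal hint]
  · congr 1
    have h := Real.integral_rpow_mul_exp_neg_mul_Ioi (a := s + 1) (by linarith) hδ
    simp only [add_sub_cancel_right] at h
    simp only [mul_left_comm _ δ, neg_mul]
    rw [integral_const_mul, h, Real.div_rpow zero_le_one hδ.le, Real.one_rpow,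
      Real.rpow_add_one hδ.ne']
    field_simp
  · filter_upwards [ae_restrict_mem measurableSet_Ioi] with t ht
    have : (0 : ℝ) < t := ht
    positivity

lemma tsum_indicator_Ioi_le_of_sum_range_le {s C : ℝ} (hs : 0 ≤ s) (hC : 0 ≤ C) {a : ℕ → ℝ}
    (ha : ∀ j, 0 ≤ a j)
    (hsum : ∀ m : ℕ, ∑ j ∈ Finset.range (m + 1), a j ≤ C * (m : ℝ) ^ s) {t : ℝ} (ht : 0 ≤ t) :
    ∑' j : ℕ, (Set.Ioi (j : ℝ)).indicator (fun _ ↦ ENNReal.ofReal (a j)) t ≤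
      ENNReal.ofReal (C * t ^ s) := by
  rw [tsum_eq_sum (s := Finset.range (⌊t⌋₊ + 1))]
  · calc
      _ ≤ ∑ j ∈ Finset.range (⌊t⌋₊ + 1), ENNReal.ofReal (a j) :=
        Finset.sum_le_sum fun j _ ↦ Set.indicator_le_self _ _ t
      _ = ENNReal.ofReal (∑ j ∈ Finset.range (⌊t⌋₊ + 1), a j) :=
        (ENNReal.ofReal_sum_of_nonneg fun j _ ↦ ha j).symm
      _ ≤ _ := by
        refine ENNReal.ofReal_le_ofReal ((hsum _).trans ?_)
        gcongr
        exact Nat.floor_le ht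
  · intro j hj
    refine Set.indicator_of_notMem (fun hjt ↦ hj ?_) _
    exact Finset.mem_range_succ_iff.mpr (Nat.le_floor (le_of_lt hjt))


/-- If the partial sums of the nonnegative sequence a are bounded by C m^{2τ}, then for every
δ > 0, ∑ a_j e^{−δj} ≤ C Γ(2τ+1)/δ^{2τ}. -/
theorem stmt7 (τ C : ℝ) (hτ : 0 < τ) (hC : 0 ≤ C) (a : ℕ → ℝ) (ha : ∀ j, 0 ≤ a j)
    (hsum : ∀ m : ℕ, ∑ j ∈ Finset.range (m + 1), a j ≤ C * (m : ℝ) ^ (2 * τ)) :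
    ∀ δ : ℝ, 0 < δ →
      ∑' j : ℕ, ENNReal.ofReal (a j * Real.exp (-δ * j)) ≤
        ENNReal.ofReal (C * Real.Gamma (2 * τ + 1) / δ ^ (2 * τ)) := by
  intro δ hδ
  set w : ℝ → ENNReal := fun t ↦ ENNReal.ofReal (δ * Real.exp (-δ * t))
  have hwm : Measurable w := by fun_prop
  have hterm (j : ℕ) : ENNReal.ofReal (a j * Real.exp (-δ * j)) =
      ∫⁻ t in Set.Ioi 0, (Set.Ioi (j : ℝ)).indicator (fun _ ↦ ENNReal.ofReal (a j)) t * w t := by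
    have hsub : Set.Ioi (j : ℝ) ∩ Set.Ioi 0 = Set.Ioi (j : ℝ) :=
      Set.inter_eq_left.mpr (Set.Ioi_subset_Ioi j.cast_nonneg)
    simp_rw [← Set.indicator_mul_left]
    rw [MeasureTheory.lintegral_indicator measurableSet_Ioi,
      MeasureTheory.Measure.restrict_restrict measurableSet_Ioi, hsub,
      MeasureTheory.lintegral_const_mul _ hwm, ← ofReal_exp_neg_mul_eq_lintegral hδ,
      ENNReal.ofReal_mul (ha j)]
  calc
    _ = ∫⁻ t in Set.Ioi 0,
        ∑' j : ℕ, (Set.Ioi (j : ℝ)).indicator (fun _ ↦ ENNReal.ofReal (a j)) t * w t := by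
      refine (tsum_congr hterm).trans (MeasureTheory.lintegral_tsum fun j ↦ ?_).symm
      exact ((measurable_const.indicator measurableSet_Ioi).mul hwm).aemeasurable
    _ ≤ ∫⁻ t in Set.Ioi 0,
        ENNReal.ofReal C * ENNReal.ofReal (t ^ (2 * τ) * (δ * Real.exp (-δ * t))) := by
      refine MeasureTheory.setLIntegral_mono' measurableSet_Ioi fun t ht ↦ ?_
      have ht0 : 0 ≤ t := le_of_lt ht
      rw [ENNReal.tsum_mul_right, ENNReal.ofReal_mul (Real.rpow_nonneg ht0 _), ← mul_assoc,
        ← ENNReal.ofReal_mul hC]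
      gcongr
      exact tsum_indicator_Ioi_le_of_sum_range_le (by positivity) hC ha hsum ht0
    _ = _ := by
      rw [MeasureTheory.lintegral_const_mul' _ _ ENNReal.ofReal_ne_top,
        lintegral_rpow_mul_exp_density hδ (by linarith), ← ENNReal.ofReal_mul hC, mul_div_assoc]
end

section
/- Let A be an r×r complex matrix and B an s×s complex matrix. Then the spectrum of the (rs)×(rs) matrix I_s ⊗ A + Bᵀ ⊗ I_r is exactly the set {λ + μ : λ ∈ spectrum(A), μ ∈ spectrum(B)}, i.e. a complex number z is an eigenvalue of I_s ⊗ A + Bᵀ ⊗ I_r if and only if z = λ + μ for some eigenvalue λ of A and some eigenvalue μ of B. -/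
open Matrix Kronecker

namespace Matrix

variable {K m n : Type*} [Fintype m] [Fintype n] [DecidableEq m] [DecidableEq n]

/-- The spectrum of a matrix over a field consists of its eigenvalues. -/
theorem mem_spectrum_iff_exists_mulVec [Field K] {M : Matrix n n K} {z : K} :
    z ∈ spectrum K M ↔ ∃ v, v ≠ 0 ∧ M *ᵥ v = z • v := by
  rw [← spectrum_toLin', ← Module.End.hasEigenvalue_iff_mem_spectrum]
  constructor
  · intro h
    obtain ⟨v, hv⟩ := h.exists_hasEigenvector
    exact ⟨v, hv.2, by simpa using hv.apply_eq_smul⟩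
  · rintro ⟨v, hv, h⟩
    exact Module.End.hasEigenvalue_of_hasEigenvector
      ⟨Module.End.mem_eigenspace_iff.mpr (by simpa using h), hv⟩

theorem spectrum_transpose [Field K] (M : Matrix n n K) : spectrum K Mᵀ = spectrum K M := by
  ext z
  simp only [mem_spectrum_iff_isRoot_charpoly, charpoly_transpose]

theorem kroneckerSum_mulVec_vec [CommRing K] (A : Matrix m m K) (B : Matrix n n K)
    (X : Matrix m n K) :
    ((1 : Matrix n n K) ⊗ₖ A + Bᵀ ⊗ₖ (1 : Matrix m m K)) *ᵥ vec X = vec (A * X + X * B) := by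
  simp [add_mulVec, kronecker_mulVec_vec]

theorem aeval_mul_of_intertwine [CommRing K] {A : Matrix m m K} {C : Matrix n n K}
    {X : Matrix m n K} (h : A * X = X * C) (p : Polynomial K) :
    Polynomial.aeval A p * X = X * Polynomial.aeval C p := by
  induction p using Polynomial.induction_on' with
  | add p q hp hq => simp [Matrix.add_mul, Matrix.mul_add, hp, hq]
  | monomial k a =>
    have hk : A ^ k * X = X * C ^ k := by
      induction k with
      | zero => simp
      | succ k ih => rw [pow_succ, Matrix.mul_assoc, h, ← Matrix.mul_assoc, ih,
          Matrix.mul_assoc, ← pow_succ]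
    simp [Polynomial.aeval_monomial, ← Algebra.smul_def, hk]

/-- Two matrices over an algebraically closed field with a nonzero intertwiner share an
eigenvalue. -/
theorem exists_mem_spectrum_of_intertwine [Field K] [IsAlgClosed K] {A : Matrix m m K}
    {C : Matrix n n K} {X : Matrix m n K} (hX : X ≠ 0) (h : A * X = X * C) :
    ∃ z, z ∈ spectrum K A ∧ z ∈ spectrum K C := by
  have : Nonempty n := by
    by_contra hn
    rw [not_nonempty_iff] at hn
    exact hX (Subsingleton.elim _ _)
  have hmul : X * Polynomial.aeval C A.charpoly = 0 := by
    rw [← aeval_mul_of_intertwine h, aeval_self_charpoly, Matrix.zero_mul]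
  have h0 : (0 : K) ∈ spectrum K (Polynomial.aeval C A.charpoly) := by
    rw [spectrum.zero_mem_iff]
    intro hu
    apply hX
    rw [isUnit_iff_isUnit_det] at hu
    rw [← mul_nonsing_inv_cancel_right _ X hu, hmul, Matrix.zero_mul]
  rw [spectrum.map_polynomial_aeval_of_nonempty _ _
    (spectrum.nonempty_of_isAlgClosed_of_finiteDimensional K C)] at h0
  obtain ⟨z, hz, hroot⟩ := h0
  exact ⟨z, mem_spectrum_iff_isRoot_charpoly.mpr hroot, hz⟩

end Matrix

/-- The spectrum of the Kronecker sum I_s ⊗ A + Bᵀ ⊗ I_r is exactly the set of sums of an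
eigenvalue of A and an eigenvalue of B. -/
theorem stmt9 (r s : ℕ) (A : Matrix (Fin r) (Fin r) ℂ) (B : Matrix (Fin s) (Fin s) ℂ) :
    spectrum ℂ
        ((1 : Matrix (Fin s) (Fin s) ℂ) ⊗ₖ A + Bᵀ ⊗ₖ (1 : Matrix (Fin r) (Fin r) ℂ)) =
      {z : ℂ | ∃ lam ∈ spectrum ℂ A, ∃ mu ∈ spectrum ℂ B, z = lam + mu} := by
  ext z
  rw [Set.mem_ofPred_eq, mem_spectrum_iff_exists_mulVec]
  constructor
  · rintro ⟨v, hv, hzv⟩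
    obtain ⟨X, rfl⟩ := vec_bijective.surjective v
    rw [kroneckerSum_mulVec_vec, ← vec_smul, vec_inj] at hzv
    have hX : X ≠ 0 := fun h => hv (vec_eq_zero_iff.mpr h)
    have hAX : A * X = X * (algebraMap ℂ _ z - B) := by
      rw [eq_sub_of_add_eq hzv, Matrix.mul_sub, Algebra.algebraMap_eq_smul_one, Matrix.mul_smul,
        Matrix.mul_one]
    obtain ⟨lam, hA, hC⟩ := exists_mem_spectrum_of_intertwine hX hAX
    rw [← spectrum.singleton_sub_eq, Set.singleton_sub] at hC
    obtain ⟨mu, hB, rfl⟩ := hC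
    exact ⟨_, hA, mu, hB, by ring⟩
  · rintro ⟨lam, hA, mu, hB, rfl⟩
    rw [← spectrum_transpose] at hB
    obtain ⟨u, hu, hAu⟩ := mem_spectrum_iff_exists_mulVec.mp hA
    obtain ⟨w, hw, hBw⟩ := mem_spectrum_iff_exists_mulVec.mp hB
    refine ⟨vec (vecMulVec u w), vec_eq_zero_iff.not.mpr ?_, ?_⟩
    · intro h
      obtain ⟨i, hi⟩ := Function.ne_iff.mp hu
      obtain ⟨j, hj⟩ := Function.ne_iff.mp hw
      exact mul_ne_zero hi hj (congrFun (congrFun h i) j)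
    · rw [kroneckerSum_mulVec_vec, ← vec_smul, mul_vecMulVec, vecMulVec_mul, hAu,
        ← mulVec_transpose, hBw, smul_vecMulVec, vecMulVec_smul, add_smul]
end

section
/- Let n ≥ 1, τ > 0, γ > 0, let 0 < s₁ < s₀, let K ≥ 1 be an integer and M > 0. Let (c_k)_{k∈ℤⁿ} be nonnegative reals with ∑_{k∈ℤⁿ} c_k² e^{2|k|s₀} ≤ 2ⁿ M², and let (D_k)_{k∈ℤⁿ, k≠0} be positive reals such that for every integer m with 1 ≤ m ≤ K, ∑_{0<|k|≤m} D_k^{−2} ≤ 2^{2n+3} m^{2τ}/γ². Then ∑_{k∈ℤⁿ, 0<|k|≤K} c_k · D_k^{−1} · e^{|k|s₁} ≤ 2^{(3n+3)/2} · Γ(2τ+1)^{1/2} · M / (γ · (2(s₀ − s₁))^{τ}). -/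
open MeasureTheory Set in
/-- Abel summation in integral form: a power bound on the counting function of the weights `w` at
the heights `N` bounds their Laplace transform by the corresponding Gamma integral. -/
theorem sum_mul_exp_neg_le_Gamma {ι : Type*} (S : Finset ι) (w N : ι → ℝ) {A a r : ℝ}
    (ha : 0 < a) (hr : 0 < r) (hN : ∀ i ∈ S, 0 ≤ N i)
    (hw : ∀ t : ℝ, 0 < t → ∑ i ∈ S with N i < t, w i ≤ A * t ^ a) :
    ∑ i ∈ S, w i * Real.exp (-(r * N i)) ≤ A * (Real.Gamma (a + 1) / r ^ a) := by
  have hgamma : ∫ t in Ioi (0 : ℝ), t ^ a * Real.exp (-(r * t)) =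
      (1 / r) ^ (a + 1) * Real.Gamma (a + 1) := by
    simpa using Real.integral_rpow_mul_exp_neg_mul_Ioi (a := a + 1) (by linarith) hr
  have hint : IntegrableOn (fun t : ℝ => t ^ a * Real.exp (-(r * t))) (Ioi 0) := by
    refine not_imp_comm.1 integral_undef ?_
    rw [hgamma]
    have := Real.Gamma_pos_of_pos (show 0 < a + 1 by linarith)
    positivity
  have hexp (i : ι) : IntegrableOn ((Ioi (N i)).indicator
      fun t => w i * (r * Real.exp (-r * t))) (Ioi 0) := by
    refine IntegrableOn.mono_set ?_ (subset_univ _)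
    rw [integrableOn_univ, integrable_indicator_iff measurableSet_Ioi]
    exact ((integrableOn_exp_mul_Ioi (neg_lt_zero.2 hr) _).const_mul r).const_mul (w i)
  have hterm : ∀ i ∈ S, w i * Real.exp (-(r * N i)) =
      ∫ t in Ioi (0 : ℝ), (Ioi (N i)).indicator (fun t => w i * (r * Real.exp (-r * t))) t := by
    intro i hi
    rw [setIntegral_indicator measurableSet_Ioi,
      inter_eq_right.2 (Ioi_subset_Ioi (hN i hi)), integral_const_mul, integral_const_mul,
      integral_exp_mul_Ioi (neg_lt_zero.2 hr)]
    field_simp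
  calc ∑ i ∈ S, w i * Real.exp (-(r * N i))
      = ∫ t in Ioi (0 : ℝ), ∑ i ∈ S,
          (Ioi (N i)).indicator (fun t => w i * (r * Real.exp (-r * t))) t := by
        rw [integral_finsetSum _ fun i _ => hexp i]
        exact Finset.sum_congr rfl hterm
    _ ≤ ∫ t in Ioi (0 : ℝ), A * r * (t ^ a * Real.exp (-(r * t))) := by
        refine setIntegral_mono_on (integrable_finsetSum _ fun i _ => hexp i)
          (hint.const_mul _) measurableSet_Ioi fun t ht => ?_
        have hsum : ∑ i ∈ S, (Ioi (N i)).indicator (fun t => w i * (r * Real.exp (-r * t))) t =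
            (∑ i ∈ S with N i < t, w i) * (r * Real.exp (-(r * t))) := by
          rw [Finset.sum_mul, Finset.sum_filter]
          simp [indicator_apply]
        rw [hsum]
        calc _ ≤ A * t ^ a * (r * Real.exp (-(r * t))) := by
              gcongr
              exact hw t ht
          _ = _ := by ring
    _ = A * (Real.Gamma (a + 1) / r ^ a) := by
        rw [integral_const_mul, hgamma, one_div, Real.inv_rpow hr.le, Real.rpow_add_one hr.ne']
        field_simp

theorem mem_Icc_of_sum_abs_le {ι : Type*} [Fintype ι] [DecidableEq ι] {k : ι → ℤ} {m : ℤ}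
    (h : ∑ l, |k l| ≤ m) :
    k ∈ Finset.Icc (fun _ => -m) fun _ => m := by
  have hl (l : ι) : |k l| ≤ m :=
    (Finset.single_le_sum (f := fun l => |k l|) (fun _ _ => abs_nonneg _)
      (Finset.mem_univ l)).trans h
  exact Finset.mem_Icc.2 ⟨fun l => (abs_le.1 (hl l)).1, fun l => (abs_le.1 (hl l)).2⟩

theorem sum_le_of_tsum_ofReal_le {ι : Type*} (S : Finset ι) {f : ι → ℝ} (hf : ∀ i, 0 ≤ f i)
    {B : ℝ} (hB : 0 ≤ B) (h : ∑' i, ENNReal.ofReal (f i) ≤ ENNReal.ofReal B) :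
    ∑ i ∈ S, f i ≤ B := by
  rw [← ENNReal.ofReal_le_ofReal_iff hB, ENNReal.ofReal_sum_of_nonneg fun i _ => hf i]
  exact (ENNReal.sum_le_tsum S).trans h


/-- Rüssmann-type estimate: given decay of the coefficients c_k on the strip of width s₀ and
bounds on partial sums of D_k⁻², the weighted sum ∑_{0<|k|≤K} c_k D_k⁻¹ e^{|k|s₁} is bounded by
2^{(3n+3)/2} Γ(2τ+1)^{1/2} M / (γ (2(s₀−s₁))^τ). -/
theorem stmt12 (n : ℕ) (hn : 1 ≤ n) (τ γ s₀ s₁ M : ℝ)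
    (hτ : 0 < τ) (hγ : 0 < γ) (hs : 0 < s₁) (hss : s₁ < s₀) (hM : 0 < M)
    (K : ℕ) (hK : 1 ≤ K)
    (c : (Fin n → ℤ) → ℝ) (hc : ∀ k, 0 ≤ c k)
    (hcsum : ∑' k : Fin n → ℤ,
        ENNReal.ofReal (c k ^ 2 * Real.exp (2 * ((∑ l, |k l| : ℤ) : ℝ) * s₀)) ≤
      ENNReal.ofReal (2 ^ n * M ^ 2))
    (D : (Fin n → ℤ) → ℝ) (hD : ∀ k, k ≠ 0 → 0 < D k)
    (hDsum : ∀ m : ℕ, 1 ≤ m → m ≤ K →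
      ∑ k ∈ (Finset.Icc (fun _ => -(m : ℤ)) fun _ => (m : ℤ)).filter
          (fun k : Fin n → ℤ => 0 < ∑ l, |k l| ∧ ∑ l, |k l| ≤ (m : ℤ)),
        (D k ^ 2)⁻¹ ≤ 2 ^ (2 * n + 3) * (m : ℝ) ^ (2 * τ) / γ ^ 2) :
    ∑ k ∈ (Finset.Icc (fun _ => -(K : ℤ)) fun _ => (K : ℤ)).filter
        (fun k : Fin n → ℤ => 0 < ∑ l, |k l| ∧ ∑ l, |k l| ≤ (K : ℤ)),
      c k * (D k)⁻¹ * Real.exp (((∑ l, |k l| : ℤ) : ℝ) * s₁) ≤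
      (2 : ℝ) ^ ((3 * (n : ℝ) + 3) / 2) * Real.sqrt (Real.Gamma (2 * τ + 1)) * M /
        (γ * (2 * (s₀ - s₁)) ^ τ) := by
  set S := (Finset.Icc (fun _ => -(K : ℤ)) fun _ => (K : ℤ)).filter
    (fun k : Fin n → ℤ => 0 < ∑ l, |k l| ∧ ∑ l, |k l| ≤ (K : ℤ))
  have hδ : 0 < s₀ - s₁ := sub_pos.2 hss
  have hcS := sum_le_of_tsum_ofReal_le S (fun k => by positivity) (by positivity) hcsum
  have hDS : ∑ k ∈ S, (D k ^ 2)⁻¹ * Real.exp (-(2 * (s₀ - s₁) * ((∑ l, |k l| : ℤ) : ℝ))) ≤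
      2 ^ (2 * n + 3) / γ ^ 2 * (Real.Gamma (2 * τ + 1) / (2 * (s₀ - s₁)) ^ (2 * τ)) := by
    refine sum_mul_exp_neg_le_Gamma S _ _ (by positivity) (by positivity) ?_ fun t ht => ?_
    · intro k hk
      exact_mod_cast (Finset.mem_filter.1 hk).2.1.le
    have hle (k : Fin n → ℤ) (hk : k ∈ S.filter fun k => ((∑ l, |k l| : ℤ) : ℝ) < t) :
        0 < ∑ l, |k l| ∧ ∑ l, |k l| ≤ ((min ⌊t⌋₊ K : ℕ) : ℤ) := by
      obtain ⟨hkS, hkt⟩ := Finset.mem_filter.1 hk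
      obtain ⟨hpos, hkK⟩ := (Finset.mem_filter.1 hkS).2
      refine ⟨hpos, ?_⟩
      rw [Nat.cast_min, Int.natCast_floor_eq_floor ht.le]
      exact le_min (Int.le_floor.2 hkt.le) hkK
    rcases Nat.eq_zero_or_pos (min ⌊t⌋₊ K) with h0 | hm
    · rw [Finset.sum_eq_zero fun k hk => absurd (hle k hk) (by rw [h0]; push_cast; lia)]
      positivity
    · calc _ ≤ _ := Finset.sum_le_sum_of_subset_of_nonneg
            (fun k hk => Finset.mem_filter.2 ⟨mem_Icc_of_sum_abs_le (hle k hk).2, hle k hk⟩)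
            fun k _ _ => by positivity
        _ ≤ _ := hDsum _ hm (min_le_right _ _)
        _ ≤ 2 ^ (2 * n + 3) * t ^ (2 * τ) / γ ^ 2 := by
            gcongr
            exact (Nat.cast_le.2 (min_le_left _ _)).trans (Nat.floor_le ht.le)
        _ = _ := by ring
  have hG := Real.Gamma_pos_of_pos (show 0 < 2 * τ + 1 by linarith)
  refine le_of_pow_le_pow_left₀ two_ne_zero (by positivity) ?_
  calc (∑ k ∈ S, c k * (D k)⁻¹ * Real.exp (((∑ l, |k l| : ℤ) : ℝ) * s₁)) ^ 2
      ≤ (∑ k ∈ S, c k ^ 2 * Real.exp (2 * ((∑ l, |k l| : ℤ) : ℝ) * s₀)) *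
        ∑ k ∈ S, (D k ^ 2)⁻¹ * Real.exp (-(2 * (s₀ - s₁) * ((∑ l, |k l| : ℤ) : ℝ))) := by
        refine Finset.sum_sq_le_sum_mul_sum_of_sq_le_mul S (fun k _ => by positivity)
          (fun k _ => by positivity) fun k _ => le_of_eq ?_
        rw [mul_mul_mul_comm, ← Real.exp_add, mul_pow, mul_pow, inv_pow, ← Real.exp_nat_mul]
        congr 2
        push_cast
        ring
    _ ≤ 2 ^ n * M ^ 2 *
        (2 ^ (2 * n + 3) / γ ^ 2 * (Real.Gamma (2 * τ + 1) / (2 * (s₀ - s₁)) ^ (2 * τ))) := by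
        gcongr
    _ = _ := by
        have h2 : ((2 : ℝ) ^ ((3 * (n : ℝ) + 3) / 2)) ^ 2 = 2 ^ n * 2 ^ (2 * n + 3) := by
          rw [← Real.rpow_mul_natCast (by norm_num), ← pow_add, ← Real.rpow_natCast]
          congr 1
          push_cast
          ring
        have hr : ((2 * (s₀ - s₁)) ^ τ) ^ 2 = (2 * (s₀ - s₁)) ^ (2 * τ) := by
          rw [← Real.rpow_mul_natCast (by positivity)]
          congr 1
          push_cast
          ring
        rw [div_pow, mul_pow, mul_pow, mul_pow, Real.sq_sqrt hG.le, h2, hr]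
        field_simp
end

section
/- Let n ≥ 1. There exists a constant C, depending only on n, with the following property: for every M > 0, every 0 < s₁ < s₀, every real K ≥ 1 with K(s₀ − s₁) ≥ 1, and every family (c_k)_{k∈ℤⁿ} of nonnegative reals satisfying ∑_{k∈ℤⁿ} c_k² e^{2|k|s₀} ≤ 2ⁿ M², one has ∑_{k∈ℤⁿ, |k| > K} c_k e^{|k|s₁} ≤ C · M · K^{n/2} · e^{−K(s₀ − s₁)}. -/
theorem ENNReal.tsum_pi_fin_prod {α : Type*} (f : α → ENNReal) (n : ℕ) :
    ∑' k : Fin n → α, ∏ l, f (k l) = (∑' j, f j) ^ n := by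
  induction n with
  | zero => simp
  | succ n ih =>
    rw [← (Fin.consEquiv fun _ => α).tsum_eq, ENNReal.tsum_prod', pow_succ', ← ih,
      ← ENNReal.tsum_mul_right]
    refine tsum_congr fun a => ?_
    rw [← ENNReal.tsum_mul_left]
    exact tsum_congr fun k => by simp [Fin.consEquiv, Fin.prod_univ_succ]

theorem hasSum_int_pow_natAbs {r : ℝ} (h0 : 0 ≤ r) (h1 : r < 1) :
    HasSum (fun j : ℤ => r ^ j.natAbs) ((1 - r)⁻¹ + r * (1 - r)⁻¹) := by
  refine HasSum.of_nat_of_neg_add_one ?_ ?_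
  · simpa using hasSum_geometric_of_lt_one h0 h1
  · have key : ∀ m : ℕ, (-((m : ℤ) + 1)).natAbs = m + 1 := fun m => by omega
    simpa only [key, pow_succ'] using (hasSum_geometric_of_lt_one h0 h1).mul_left r

theorem tsum_int_ofReal_exp_neg_abs_le {K : ℝ} (hK : 1 ≤ K) :
    ∑' j : ℤ, ENNReal.ofReal (Real.exp (-(2 * (|j| : ℤ) / K))) ≤ ENNReal.ofReal (2 * K) := by
  have hK0 : 0 < K := by linarith
  set r := Real.exp (-(2 / K)) with hr
  have hr0 : 0 < r := Real.exp_pos _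
  have hr1 : r < 1 := by
    have : 0 < 2 / K := by positivity
    rw [hr, Real.exp_lt_one_iff]
    linarith
  have hterm (j : ℤ) : Real.exp (-(2 * (|j| : ℤ) / K)) = r ^ j.natAbs := by
    rw [hr, ← Real.exp_nat_mul, Nat.cast_natAbs]
    ring_nf
  have hs := hasSum_int_pow_natAbs hr0.le hr1
  simp_rw [hterm]
  rw [← ENNReal.ofReal_tsum_of_nonneg (fun j => by positivity) hs.summable, hs.tsum_eq]
  refine ENNReal.ofReal_le_ofReal ?_
  have hrK : r * (1 + 2 / K) ≤ 1 := by
    have h := Real.add_one_le_exp (2 / K)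
    calc r * (1 + 2 / K) ≤ r * Real.exp (2 / K) := by gcongr; linarith
      _ = 1 := by rw [hr, ← Real.exp_add]; simp
  have hrK' : r * (K + 2) ≤ K := by
    have := mul_le_mul_of_nonneg_right hrK hK0.le
    field_simp at this
    linarith
  rw [show (1 - r)⁻¹ + r * (1 - r)⁻¹ = (1 + r) / (1 - r) by ring, div_le_iff₀ (by linarith)]
  nlinarith

theorem tsum_pi_ofReal_exp_neg_abs_le (n : ℕ) {K : ℝ} (hK : 1 ≤ K) :
    ∑' k : Fin n → ℤ, ENNReal.ofReal (Real.exp (-(2 * ((∑ l, |k l| : ℤ) : ℝ) / K))) ≤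
      ENNReal.ofReal ((2 * K) ^ n) := by
  have hterm (k : Fin n → ℤ) :
      ENNReal.ofReal (Real.exp (-(2 * ((∑ l, |k l| : ℤ) : ℝ) / K))) =
        ∏ l, ENNReal.ofReal (Real.exp (-(2 * (|k l| : ℤ) / K))) := by
    rw [← ENNReal.ofReal_prod_of_nonneg fun l _ => (Real.exp_pos _).le, ← Real.exp_sum]
    push_cast
    rw [Finset.sum_neg_distrib, Finset.mul_sum, Finset.sum_div]
  simp_rw [hterm]
  rw [ENNReal.tsum_pi_fin_prod fun j : ℤ => ENNReal.ofReal (Real.exp (-(2 * (|j| : ℤ) / K))),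
    ENNReal.ofReal_pow (by linarith)]
  gcongr
  exact tsum_int_ofReal_exp_neg_abs_le hK

theorem mul_exp_le_of_lt {M u s₀ s₁ K m c : ℝ} (hM : 0 < M) (hu : 0 < u) (hK : 1 ≤ K)
    (hKs : 1 ≤ K * (s₀ - s₁)) (hc : 0 ≤ c) (hm : K < m) :
    c * Real.exp (m * s₁) ≤ u / (2 * M) * (c ^ 2 * Real.exp (2 * m * s₀)) +
      M / (2 * u) * Real.exp (1 - K * (s₀ - s₁)) ^ 2 * Real.exp (-(2 * m / K)) := by
  have hK0 : 0 < K := by linarith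
  set a := c * Real.exp (m * s₀) with ha
  set b := Real.exp (1 - K * (s₀ - s₁)) * Real.exp (-(m / K)) with hb
  have ha2 : c ^ 2 * Real.exp (2 * m * s₀) = a ^ 2 := by
    rw [ha, mul_pow, ← Real.exp_nat_mul]
    push_cast
    ring_nf
  have hb2 : Real.exp (1 - K * (s₀ - s₁)) ^ 2 * Real.exp (-(2 * m / K)) = b ^ 2 := by
    rw [hb, mul_pow, ← Real.exp_nat_mul (-(m / K))]
    push_cast
    ring_nf
  have hexp : Real.exp (m * s₁) ≤ Real.exp (m * s₀) * b := by
    rw [hb, ← Real.exp_add, ← Real.exp_add, Real.exp_le_exp]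
    have h1 : 1 / K ≤ s₀ - s₁ := by rw [div_le_iff₀ hK0]; linarith
    have h2 : 0 ≤ (m - K) * (s₀ - s₁ - 1 / K) := mul_nonneg (by linarith) (by linarith)
    have h3 : (m - K) * (s₀ - s₁ - 1 / K) =
        m * s₀ + (1 - K * (s₀ - s₁) + -(m / K)) - m * s₁ := by
      field_simp
      ring
    linarith
  have hab : a * b ≤ u / (2 * M) * a ^ 2 + M / (2 * u) * b ^ 2 := by
    have h : u / (2 * M) * a ^ 2 + M / (2 * u) * b ^ 2 - a * b =
        (u * a - M * b) ^ 2 / (2 * M * u) := by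
      field_simp
      ring
    have : 0 ≤ (u * a - M * b) ^ 2 / (2 * M * u) := by positivity
    linarith
  rw [mul_assoc (M / (2 * u)), ha2, hb2]
  calc c * Real.exp (m * s₁) ≤ c * (Real.exp (m * s₀) * b) := by gcongr
    _ = a * b := by rw [ha]; ring
    _ ≤ _ := hab

/-- There is a constant C = C(n) such that for every M > 0, 0 < s₁ < s₀, every K ≥ 1 with
K(s₀−s₁) ≥ 1 and every nonnegative family (c_k) with ∑ c_k² e^{2|k|s₀} ≤ 2ⁿM²,
one has ∑_{|k|>K} c_k e^{|k|s₁} ≤ C M K^{n/2} e^{−K(s₀−s₁)}. -/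
theorem stmt14 (n : ℕ) (hn : 1 ≤ n) :
    ∃ C : ℝ, ∀ M s₀ s₁ K : ℝ, 0 < M → 0 < s₁ → s₁ < s₀ → 1 ≤ K → 1 ≤ K * (s₀ - s₁) →
      ∀ c : (Fin n → ℤ) → ℝ, (∀ k, 0 ≤ c k) →
        (∑' k : Fin n → ℤ,
            ENNReal.ofReal (c k ^ 2 * Real.exp (2 * ((∑ l, |k l| : ℤ) : ℝ) * s₀)) ≤
          ENNReal.ofReal (2 ^ n * M ^ 2)) →
        ∑' k : {k : Fin n → ℤ // K < ((∑ l, |k l| : ℤ) : ℝ)},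
            ENNReal.ofReal (c k.1 * Real.exp (((∑ l, |k.1 l| : ℤ) : ℝ) * s₁)) ≤
          ENNReal.ofReal (C * M * K ^ ((n : ℝ) / 2) * Real.exp (-K * (s₀ - s₁))) := by
  refine ⟨2 ^ n * Real.exp 1, fun M s₀ s₁ K hM _ _ hK hKs c hc hsum => ?_⟩
  have hK0 : 0 < K := by linarith
  set P := K ^ ((n : ℝ) / 2) with hP
  have hP0 : 0 < P := Real.rpow_pos_of_pos hK0 _
  have hP2 : P ^ 2 = K ^ n := by
    rw [hP, ← Real.rpow_natCast, ← Real.rpow_mul hK0.le, ← Real.rpow_natCast K n]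
    congr 1
    push_cast
    ring
  set E := Real.exp (1 - K * (s₀ - s₁)) with hE
  have hE0 : 0 < E := Real.exp_pos _
  have hu : 0 < E * P := by positivity
  calc _ ≤ ∑' k : {k : Fin n → ℤ // K < ((∑ l, |k l| : ℤ) : ℝ)},
        (ENNReal.ofReal (E * P / (2 * M)) *
            ENNReal.ofReal (c k.1 ^ 2 * Real.exp (2 * ((∑ l, |k.1 l| : ℤ) : ℝ) * s₀)) +
          ENNReal.ofReal (M / (2 * (E * P)) * E ^ 2) *
            ENNReal.ofReal (Real.exp (-(2 * ((∑ l, |k.1 l| : ℤ) : ℝ) / K)))) := by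
        refine ENNReal.tsum_le_tsum fun k => ?_
        rw [← ENNReal.ofReal_mul (by positivity), ← ENNReal.ofReal_mul (by positivity),
          ← ENNReal.ofReal_add (by positivity) (by positivity)]
        exact ENNReal.ofReal_le_ofReal (mul_exp_le_of_lt hM hu hK hKs (hc _) k.2)
    _ ≤ ∑' k : Fin n → ℤ,
        (ENNReal.ofReal (E * P / (2 * M)) *
            ENNReal.ofReal (c k ^ 2 * Real.exp (2 * ((∑ l, |k l| : ℤ) : ℝ) * s₀)) +
          ENNReal.ofReal (M / (2 * (E * P)) * E ^ 2) *
            ENNReal.ofReal (Real.exp (-(2 * ((∑ l, |k l| : ℤ) : ℝ) / K)))) :=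
        ENNReal.tsum_comp_le_tsum_of_injective Subtype.val_injective _
    _ ≤ ENNReal.ofReal (E * P / (2 * M)) * ENNReal.ofReal (2 ^ n * M ^ 2) +
          ENNReal.ofReal (M / (2 * (E * P)) * E ^ 2) * ENNReal.ofReal ((2 * K) ^ n) := by
        rw [ENNReal.tsum_add, ENNReal.tsum_mul_left, ENNReal.tsum_mul_left]
        gcongr
        exact tsum_pi_ofReal_exp_neg_abs_le n hK
    _ = _ := by
        rw [← ENNReal.ofReal_mul (by positivity), ← ENNReal.ofReal_mul (by positivity),
          ← ENNReal.ofReal_add (by positivity) (by positivity)]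
        congr 1
        have hE' : E = Real.exp 1 * Real.exp (-K * (s₀ - s₁)) := by
          rw [hE, ← Real.exp_add]
          ring_nf
        calc _ = 2 ^ n * E * M * P := by
              rw [mul_pow, ← hP2]
              field_simp
              ring
          _ = _ := by rw [hE']; ring
end
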